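/- arXiv:1706.08290 — 2 statements merged into one kernel-verified Lean document; each statement's English description precedes it below -/
import Mathlib

section
/- Let p and q be primes with q dividing p − 1, and let G be a nonabelian group of order pq (equivalently, G has a normal subgroup N of order p with C_G(N) = N and G/N cyclic of order q). Then β(G) ≤ p · q^{0.8}. -/
/-!  Definition of the Noether number `β(G)` of a group `G`, over the field `ℂ`
(of characteristic 0).  A finite-dimensional `ℂG`-module is (up to isomorphism)
given by a representation `ρ : Representation ℂ G (Fin n → ℂ)`; the algebra of
polynomial invariants is realised inside `MvPolynomial (Fin n) ℂ` as the
common equalizer of the substitution maps induced by the group elements. -/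

/-- The algebra endomorphism of the polynomial ring induced by the linear action of
`g : G` on the underlying space (substitution of the variables by linear forms). -/
noncomputable def Representation.polySubst {G : Type*} [Group G] {n : ℕ}
    (ρ : Representation ℂ G (Fin n → ℂ)) (g : G) :
    MvPolynomial (Fin n) ℂ →ₐ[ℂ] MvPolynomial (Fin n) ℂ :=
  MvPolynomial.aeval fun i =>
    ∑ j, MvPolynomial.C (LinearMap.toMatrix' (ρ g) i j) * MvPolynomial.X j

/-- The subalgebra of `G`-invariant polynomials. -/
noncomputable def Representation.invariantAlgebra {G : Type*} [Group G] {n : ℕ}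
    (ρ : Representation ℂ G (Fin n → ℂ)) : Subalgebra ℂ (MvPolynomial (Fin n) ℂ) :=
  ⨅ g : G, AlgHom.equalizer (ρ.polySubst g) (AlgHom.id ℂ (MvPolynomial (Fin n) ℂ))

/-- The invariant algebra is generated by its elements of (total) degree at most `d`. -/
def Representation.InvariantsGeneratedInDegree {G : Type*} [Group G] {n : ℕ}
    (ρ : Representation ℂ G (Fin n → ℂ)) (d : ℕ) : Prop :=
  Algebra.adjoin ℂ {f : MvPolynomial (Fin n) ℂ | f ∈ ρ.invariantAlgebra ∧ f.totalDegree ≤ d}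
    = ρ.invariantAlgebra

/-- The Noether number `β(G)`: the smallest degree bound `d` such that for every
finite-dimensional `ℂG`-module the algebra of polynomial invariants is generated
by its elements of degree at most `d`.  (Equivalently, the maximum over all
finite-dimensional modules `V` of the minimal generating degree `β(G,V)`.) -/
noncomputable def noetherNumber (G : Type*) [Group G] : ℕ :=
  sInf {d : ℕ | ∀ (n : ℕ) (ρ : Representation ℂ G (Fin n → ℂ)),
    ρ.InvariantsGeneratedInDegree d}

/-- The Noether index `n(G) = |G| / β(G)`, as a real number. -/
noncomputable def noetherIndex (G : Type*) [Group G] : ℝ :=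
  (Nat.card G : ℝ) / (noetherNumber G : ℝ)

section

open Finset Pointwise

/-- The multiplicity of the value `x` in the sequence `w` indexed by `S`. -/
def weightMult {ι : Type*} {p : ℕ} (w : ι → ZMod p) (S : Finset ι) (x : ZMod p) : ℕ :=
  #{i ∈ S | w i = x}

lemma sum_weightMult {ι : Type*} {p : ℕ} [NeZero p] (w : ι → ZMod p) (S : Finset ι) :
    ∑ x, weightMult w S x = #S :=
  (Finset.card_eq_sum_card_fiberwise (fun _ _ => Finset.mem_coe.2 (Finset.mem_univ _))).symm

lemma weightMult_mono {ι : Type*} {p : ℕ} (w : ι → ZMod p) {S T : Finset ι} (h : S ⊆ T)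
    (x : ZMod p) : weightMult w S x ≤ weightMult w T x :=
  Finset.card_le_card (Finset.filter_subset_filter _ h)

lemma exists_transversal {ι : Type*} [DecidableEq ι] {p : ℕ} [NeZero p] (w : ι → ZMod p)
    (S : Finset ι) (h : ℕ) :
    ∃ C ⊆ S, Set.InjOn w C ∧ C.image w = S.image w ∧
      ∑ x, min (weightMult w (S \ C) x) h + #(S.image w) =
        ∑ x, min (weightMult w S x) (h + 1) := by
  obtain ⟨C, hCS, hC, hinj⟩ : ∃ C ⊆ S, C.image w = S.image w ∧ Set.InjOn w C := by
    have := Finset.subset_image_iff.1 (subset_refl (S.image w))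
    obtain ⟨s, hs, h1, h2⟩ := (Set.surjOn_image w (S : Set ι)).exists_subset_injOn_image_eq
    have hfin : s.Finite := S.finite_toSet.subset hs
    refine ⟨hfin.toFinset, by simpa using hs, ?_, by simpa using h1⟩
    apply Finset.coe_injective
    simpa using h2
  refine ⟨C, hCS, hinj, hC, ?_⟩
  have hcard : #(S.image w) = ∑ x, if x ∈ S.image w then 1 else 0 := by
    rw [Finset.sum_ite_mem]; simp
  rw [hcard, ← Finset.sum_add_distrib]
  refine Finset.sum_congr rfl fun x _ => ?_
  have hsd : weightMult w (S \ C) x + weightMult w C x = weightMult w S x := by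
    unfold weightMult
    rw [← Finset.card_union_of_disjoint, ← Finset.filter_union,
      Finset.sdiff_union_of_subset hCS]
    exact Finset.disjoint_filter_filter Finset.sdiff_disjoint
  have hCx : weightMult w C x = if x ∈ S.image w then 1 else 0 := by
    rw [← hC]
    unfold weightMult
    split_ifs with hx
    · obtain ⟨i, hi, rfl⟩ := Finset.mem_image.1 hx
      refine Finset.card_eq_one.2 ⟨i, ?_⟩
      ext j
      simp only [mem_filter, mem_singleton]
      exact ⟨fun hj => hinj hj.1 hi hj.2, by rintro rfl; exact ⟨hi, rfl⟩⟩
    · rw [Finset.card_eq_zero, Finset.filter_eq_empty_iff]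
      intro i hi hix
      exact hx (Finset.mem_image.2 ⟨i, hi, hix⟩)
  split_ifs at hCx ⊢ with hx
  · omega
  · have : weightMult w S x = 0 := by
      unfold weightMult
      rw [Finset.card_eq_zero, Finset.filter_eq_empty_iff]
      intro i hi hix
      exact hx (Finset.mem_image.2 ⟨i, hi, hix⟩)
    omega

lemma exists_subset_sums {ι : Type*} [DecidableEq ι] {p : ℕ} [Fact p.Prime] (w : ι → ZMod p)
    (h : ℕ) : ∀ S : Finset ι, (∀ i ∈ S, w i ≠ 0) →
    ∃ B : Finset (ZMod p), min p (1 + ∑ x, min (weightMult w S x) h) ≤ #B ∧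
      ∀ b ∈ B, ∃ I ⊆ S, #I ≤ h ∧ ∑ i ∈ I, w i = b := by
  induction h with
  | zero =>
    intro S _
    refine ⟨{0}, by simp, fun b hb => ⟨∅, by simp, by simp, ?_⟩⟩
    simpa using (Finset.mem_singleton.1 hb).symm
  | succ h ih =>
    intro S hS
    obtain ⟨C, hCS, -, hC, hsum⟩ := exists_transversal w S h
    obtain ⟨B, hB, hB'⟩ := ih (S \ C) fun i hi => hS i (Finset.sdiff_subset hi)
    have hpos := (Fact.out : p.Prime).pos
    have hBne : B.Nonempty := by
      rw [← Finset.card_pos]; omega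
    have h0 : (0 : ZMod p) ∉ C.image w := by
      intro h0
      obtain ⟨i, hi, hi0⟩ := Finset.mem_image.1 h0
      exact hS i (hCS hi) hi0
    refine ⟨B + insert 0 (C.image w), ?_, ?_⟩
    · have := ZMod.cauchy_davenport (Fact.out : p.Prime) hBne
        (Finset.insert_nonempty 0 (C.image w))
      rw [Finset.card_insert_of_notMem h0, hC] at this
      rw [hC]
      omega
    · intro b hb
      obtain ⟨x, hx, y, hy, rfl⟩ := Finset.mem_add.1 hb
      obtain ⟨I, hIS, hIc, hI⟩ := hB' x hx
      rcases Finset.mem_insert.1 hy with rfl | hy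
      · exact ⟨I, hIS.trans Finset.sdiff_subset, by omega, by simp [hI]⟩
      · obtain ⟨c, hc, rfl⟩ := Finset.mem_image.1 hy
        have hcI : c ∉ I := fun hcI => (Finset.mem_sdiff.1 (hIS hcI)).2 hc
        refine ⟨insert c I, ?_, ?_, ?_⟩
        · exact Finset.insert_subset (hCS hc) (hIS.trans Finset.sdiff_subset)
        · rw [Finset.card_insert_of_notMem hcI]; omega
        · rw [Finset.sum_insert hcI, hI, add_comm]

lemma exists_short_zero_sum {ι : Type*} [DecidableEq ι] {p : ℕ} [Fact p.Prime]
    (w : ι → ZMod p) (S : Finset ι) (h : ℕ) (hh : 0 < h)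
    (hS : p ≤ ∑ x ∈ univ.erase 0, min (weightMult w S x) h ∨ ∃ i ∈ S, w i = 0) :
    ∃ I ⊆ S, I.Nonempty ∧ #I ≤ h ∧ ∑ i ∈ I, w i = 0 := by
  by_cases h0 : ∃ i ∈ S, w i = 0
  · obtain ⟨i, hi, hi0⟩ := h0
    exact ⟨{i}, by simpa using hi, by simp, by simpa using Nat.succ_le_of_lt hh,
      by simpa using hi0⟩
  replace hS := (hS.resolve_right h0).trans
    (Finset.sum_le_sum_of_subset (Finset.erase_subset 0 univ))
  push Not at h0
  obtain ⟨h, rfl⟩ : ∃ k, h = k + 1 := ⟨h - 1, by omega⟩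
  obtain ⟨C, hCS, -, hC, hsum⟩ := exists_transversal w S h
  obtain ⟨B, hB, hB'⟩ := exists_subset_sums w h (S \ C) fun i hi => h0 i (Finset.sdiff_subset hi)
  have hpos := (Fact.out : p.Prime).pos
  have hBne : B.Nonempty := by
    rw [← Finset.card_pos]; omega
  have hCne : (C.image w).Nonempty := by
    rw [Finset.image_nonempty]
    by_contra hne
    rw [Finset.not_nonempty_iff_eq_empty] at hne
    subst hne
    rw [Finset.image_empty, eq_comm, Finset.image_eq_empty] at hC
    subst hC
    simp [weightMult] at hS
    omega
  have hcd := ZMod.cauchy_davenport (Fact.out : p.Prime) hBne hCne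
  have huniv : B + C.image w = univ := by
    rw [← Finset.card_eq_iff_eq_univ, ZMod.card]
    have := Finset.card_le_univ (B + C.image w)
    rw [ZMod.card] at this
    have hpos' := hCne.card_pos
    rw [hC] at hcd this hpos' ⊢
    omega
  obtain ⟨x, hx, y, hy, hxy⟩ := Finset.mem_add.1 (huniv ▸ Finset.mem_univ (0 : ZMod p))
  obtain ⟨I, hIS, hIc, hI⟩ := hB' x hx
  obtain ⟨c, hc, rfl⟩ := Finset.mem_image.1 hy
  have hcI : c ∉ I := fun hcI => (Finset.mem_sdiff.1 (hIS hcI)).2 hc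
  refine ⟨insert c I, ?_, by simp, ?_, ?_⟩
  · exact Finset.insert_subset (hCS hc) (hIS.trans Finset.sdiff_subset)
  · rw [Finset.card_insert_of_notMem hcI]; omega
  · rw [Finset.sum_insert hcI, hI, add_comm, hxy]

/-- `HasZeroSums w n S`: one can split off `n` nonempty zero-sum blocks from the sequence indexed
by `S` in such a way that something is left over. -/
def HasZeroSums {ι : Type*} [DecidableEq ι] {p : ℕ} (w : ι → ZMod p) : ℕ → Finset ι → Prop
  | 0, S => S.Nonempty
  | n + 1, S => ∃ I ⊆ S, I.Nonempty ∧ ∑ i ∈ I, w i = 0 ∧ HasZeroSums w n (S \ I)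

lemma exists_zero_sum_of_bounds {ι : Type*} [DecidableEq ι] {p : ℕ} [Fact p.Prime]
    (w : ι → ZMod p) (S : Finset ι) (K : ℕ → ℝ)
    (hK : ∀ A : Finset (ZMod p), 0 ∉ A → A.Nonempty → (∑ x ∈ A, weightMult w S x : ℕ) ≤ K #A)
    (h : ℕ) (hh : 0 < h) (hp : p ≤ #S)
    (hKh : ∀ i : ℕ, 0 < i → (p : ℝ) ≤ i * h ∨ K i + p ≤ #S + i * h) :
    ∃ I ⊆ S, I.Nonempty ∧ #I ≤ h ∧ ∑ i ∈ I, w i = 0 := by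
  apply exists_short_zero_sum w S h hh
  by_contra! hcon
  obtain ⟨hlt, hne⟩ := hcon
  have h0 : weightMult w S 0 = 0 := by
    unfold weightMult
    rw [Finset.card_eq_zero, Finset.filter_eq_empty_iff]
    exact fun i hi => hne i hi
  set A : Finset (ZMod p) := {x ∈ univ.erase 0 | h ≤ weightMult w S x} with hA
  have hs : ∑ x ∈ univ.erase (0 : ZMod p), weightMult w S x = #S := by
    rw [← sum_weightMult w S, ← Finset.sum_erase_add univ _ (Finset.mem_univ (0 : ZMod p)), h0,
      add_zero]
  rw [← Finset.sum_filter_add_sum_filter_not _ (fun x => h ≤ weightMult w S x)] at hs hlt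
  rw [← hA] at hs hlt
  have h1 : ∑ x ∈ A, min (weightMult w S x) h = #A * h := by
    rw [Finset.sum_congr rfl (g := fun _ => h), Finset.sum_const, smul_eq_mul]
    intro x hx
    exact min_eq_right (Finset.mem_filter.1 hx).2
  have h2 : ∑ x ∈ univ.erase (0 : ZMod p) with ¬ h ≤ weightMult w S x, min (weightMult w S x) h =
      ∑ x ∈ univ.erase (0 : ZMod p) with ¬ h ≤ weightMult w S x, weightMult w S x := by
    refine Finset.sum_congr rfl fun x hx => min_eq_left ?_
    have := (Finset.mem_filter.1 hx).2
    omega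
  rw [h1, h2] at hlt
  rcases A.eq_empty_or_nonempty with hAe | hAne
  · rw [hAe, Finset.sum_empty] at hs
    rw [hAe, Finset.card_empty] at hlt
    omega
  · have hKA := hK A (by simp [hA]) hAne
    have hs' : (#S : ℝ) = ((∑ x ∈ A, weightMult w S x : ℕ) : ℝ) +
      ((∑ x ∈ univ.erase (0 : ZMod p) with ¬ h ≤ weightMult w S x, weightMult w S x : ℕ) : ℝ) := by
      rw [← hs]; push_cast; rfl
    have hlt' : ((#A : ℝ) * h + ((∑ x ∈ univ.erase (0 : ZMod p) with
        ¬ h ≤ weightMult w S x, weightMult w S x : ℕ) : ℝ)) < p := by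
      exact_mod_cast hlt
    have hnn : (0 : ℝ) ≤ ((∑ x ∈ univ.erase (0 : ZMod p) with
        ¬ h ≤ weightMult w S x, weightMult w S x : ℕ) : ℝ) := Nat.cast_nonneg _
    rcases hKh #A hAne.card_pos with h3 | h3 <;> linarith

/-- Every subsequence of `S` of length at least `s` admits `n` disjoint zero-sum blocks that do not
exhaust it. -/
def ZeroSumsFrom {ι : Type*} [DecidableEq ι] {p : ℕ} (w : ι → ZMod p) (S : Finset ι) (n s : ℕ) :
    Prop :=
  ∀ S' ⊆ S, s ≤ #S' → HasZeroSums w n S'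

lemma zeroSumsFrom_zero {ι : Type*} [DecidableEq ι] {p : ℕ} (w : ι → ZMod p) (S : Finset ι)
    {s : ℕ} (hs : 0 < s) : ZeroSumsFrom w S 0 s := by
  intro S' _ h
  exact Finset.card_pos.1 (hs.trans_le h)

lemma ZeroSumsFrom.succ {ι : Type*} [DecidableEq ι] {p : ℕ} [Fact p.Prime]
    {w : ι → ZMod p} {S : Finset ι} {K : ℕ → ℝ}
    (hK : ∀ A : Finset (ZMod p), 0 ∉ A → A.Nonempty → (∑ x ∈ A, weightMult w S x : ℕ) ≤ K #A)
    {n s : ℕ} (h : ℕ) (hh : 0 < h) (hp : p ≤ s)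
    (hKh : ∀ i : ℕ, 0 < i → (p : ℝ) ≤ i * h ∨ K i + p ≤ s + i * h)
    (hn : ZeroSumsFrom w S n (s - h)) : ZeroSumsFrom w S (n + 1) s := by
  intro S' hS' hs
  have hs' : (s : ℝ) ≤ #S' := by exact_mod_cast hs
  obtain ⟨I, hIS, hIne, hIc, hI⟩ := exists_zero_sum_of_bounds w S' K (fun A h0 hA =>
    le_trans (by exact_mod_cast Finset.sum_le_sum fun x _ => weightMult_mono w hS' x)
      (hK A h0 hA)) h hh (hp.trans hs)
    (fun i hi => (hKh i hi).imp id fun h3 => h3.trans (by linarith))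
  refine ⟨I, hIS, hIne, hI, hn _ (Finset.sdiff_subset.trans hS') ?_⟩
  rw [Finset.card_sdiff_of_subset hIS]
  omega

/-- The sequence `w` indexed by `S` has no large gaps between its multiplicities inside the orbits
of the multiplication by `κ`. -/
def IsGapless {ι : Type*} {p : ℕ} (w : ι → ZMod p) (S : Finset ι) (κ : ZMod p) (q : ℕ) : Prop :=
  ∀ T : Finset (ZMod p), T.Nonempty → 0 ∉ T → #T < q →
    ∃ x ∈ T, ∃ y ∉ T, (∃ j : ℕ, y = κ ^ j * x) ∧ weightMult w S x ≤ weightMult w S y + p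

/-- Upper bound for the sum of the `l` largest multiplicities in a gapless sequence of
length `d`. -/
noncomputable def topBound (p d t l : ℕ) : ℝ :=
  if l ≤ t then l * d / t + p * l * (t - l) / 2 else d

lemma sum_weightMult_le_card {ι : Type*} {p : ℕ} [NeZero p] (w : ι → ZMod p) (S : Finset ι)
    (A : Finset (ZMod p)) : ∑ x ∈ A, weightMult w S x ≤ #S := by
  rw [← sum_weightMult w S]
  exact Finset.sum_le_sum_of_subset (Finset.subset_univ A)

lemma IsGapless.sum_le {ι : Type*} {p : ℕ} [Fact p.Prime] {w : ι → ZMod p}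
    {S : Finset ι} {κ : ZMod p} {q : ℕ} (hκ : κ ≠ 0) (hS : IsGapless w S κ q) {t : ℕ} (ht : 0 < t)
    (htq : t ≤ q) (A : Finset (ZMod p)) (hA : 0 ∉ A) :
    (∑ x ∈ A, weightMult w S x : ℕ) ≤ topBound p #S t #A := by
  classical
  unfold topBound
  split_ifs with hAt
  swap
  · exact_mod_cast sum_weightMult_le_card w S A
  have ht' : (0 : ℝ) < t := by exact_mod_cast ht
  set g : Finset (ZMod p) → ℝ := fun A => (∑ x ∈ A, weightMult w S x : ℕ) -
    (#A * #S / t + p * #A * (t - #A) / 2 : ℝ) with hg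
  suffices hgA : g A ≤ 0 by simpa [hg] using hgA
  obtain ⟨M, hM, hmax⟩ := Finset.exists_max_image
    ((univ : Finset (Finset (ZMod p))).filter fun A => 0 ∉ A ∧ #A ≤ t) g
    ⟨A, by simp [hA, hAt]⟩
  refine (hmax A (by simp [hA, hAt])).trans ?_
  by_contra! hpos
  have key : ∀ l : ℕ, ∀ B : Finset (ZMod p), #B = l → 0 ∉ B → l ≤ t → g B ≠ g M := by
    intro l
    induction l with
    | zero =>
      intro B hB _ _ hBM
      rw [Finset.card_eq_zero] at hB
      subst hB
      simp [hg] at hBM hpos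
      linarith
    | succ l ih =>
      intro B hB h0B hlt hBM
      rcases hlt.eq_or_lt with hlt | hlt
      · have h1 : (∑ x ∈ B, weightMult w S x : ℕ) ≤ (#S : ℝ) := by
          exact_mod_cast sum_weightMult_le_card w S B
        have h2 : g B ≤ 0 := by
          simp only [hg, hB, hlt, sub_self, mul_zero, zero_div, add_zero]
          rw [mul_div_assoc, mul_div_cancel₀ _ ht'.ne']
          linarith
        linarith
      · obtain ⟨x, hx, y, hy, ⟨j, hj⟩, hxy⟩ := hS B (Finset.card_pos.1 (by omega)) h0B (by omega)
        have hx0 : x ≠ 0 := by rintro rfl; exact h0B hx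
        have hy0 : y ≠ 0 := by
          rw [hj]; exact mul_ne_zero (pow_ne_zero _ hκ) hx0
        have hc1 : #(B.erase x) = l := by rw [Finset.card_erase_of_mem hx]; omega
        have hc2 : #(insert y B) = l + 2 := by rw [Finset.card_insert_of_notMem hy]; omega
        have h01 : 0 ∉ B.erase x := fun h => h0B (Finset.mem_of_mem_erase h)
        have h02 : 0 ∉ insert y B := by
          simp only [Finset.mem_insert, not_or]; exact ⟨hy0.symm, h0B⟩
        have hne := ih (B.erase x) hc1 h01 (by omega)
        have hle1 := hmax (B.erase x) (by simp only [mem_filter, mem_univ, true_and]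
                                          exact ⟨h01, by omega⟩)
        have hle2 := hmax (insert y B) (by simp only [mem_filter, mem_univ, true_and]
                                           exact ⟨h02, by omega⟩)
        have hlt1 := lt_of_le_of_ne hle1 hne
        have hs1 : ((∑ z ∈ B, weightMult w S z : ℕ) : ℝ) =
            (∑ z ∈ B.erase x, weightMult w S z : ℕ) + weightMult w S x := by
          exact_mod_cast (Finset.sum_erase_add B _ hx).symm
        have hs2 : ((∑ z ∈ insert y B, weightMult w S z : ℕ) : ℝ) =
            (∑ z ∈ B, weightMult w S z : ℕ) + weightMult w S y := by
          rw [Finset.sum_insert hy]; push_cast; ring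
        have hxy' : (weightMult w S x : ℝ) ≤ weightMult w S y + p := by exact_mod_cast hxy
        rw [← hBM] at hlt1 hle2
        simp only [hg, hc1, hc2, hB] at hlt1 hle2
        rw [hs2] at hle2
        rw [hs1] at hlt1 hle2
        push_cast at hlt1 hle2
        have e1 : ((l : ℝ) + 2) * #S / t = l * #S / t + 2 * (#S / t) := by ring
        have e2 : ((l : ℝ) + 1) * #S / t = l * #S / t + #S / t := by ring
        rw [e2] at hlt1 hle2
        rw [e1] at hle2
        nlinarith
  exact key #M M rfl (Finset.mem_filter.1 hM).2.1 (Finset.mem_filter.1 hM).2.2 rfl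

lemma topBound_of_le {p d t l : ℕ} (h : l ≤ t) :
    topBound p d t l = l * d / t + p * l * (t - l) / 2 := if_pos h

lemma topBound_add_le {p d t i j : ℕ} (hd : p * (t * (t - 1)) ≤ 2 * d) (hij : i < j) (hj : j < t) :
    topBound p d t i + p ≤ topBound p d t j := by
  rw [topBound_of_le (by omega), topBound_of_le (by omega)]
  have ht : (0 : ℝ) < t := by exact_mod_cast (show 0 < t by omega)
  obtain ⟨u, rfl⟩ : ∃ u, t = u + 1 := ⟨t - 1, by omega⟩
  have hd' : (p : ℝ) * u / 2 ≤ d / (u + 1 : ℕ) := by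
    rw [div_le_div_iff₀ two_pos ht]
    have : p * u * (u + 1) ≤ d * 2 := by
      calc p * u * (u + 1) = p * ((u + 1) * (u + 1 - 1)) := by rw [Nat.add_sub_cancel]; ring
        _ ≤ d * 2 := by omega
    exact_mod_cast this
  set e : ℝ := d / (u + 1 : ℕ) with he
  have e1 : (i : ℝ) * d / (u + 1 : ℕ) = i * e := by rw [he]; ring
  have e2 : (j : ℝ) * d / (u + 1 : ℕ) = j * e := by rw [he]; ring
  rw [e1, e2]
  have hij' : (i : ℝ) + 1 ≤ j := by exact_mod_cast hij
  have hj' : (j : ℝ) ≤ u := by exact_mod_cast (show j ≤ u by omega)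
  push_cast
  have hp : (0 : ℝ) ≤ p := Nat.cast_nonneg p
  have key : (j - i : ℝ) * (p * (2 * u + 1 - j - i) / 2) ≤
      (j - i : ℝ) * (e + p * (u + 1 - j - i) / 2) :=
    mul_le_mul_of_nonneg_left (by nlinarith) (by linarith)
  have key2 : (1 : ℝ) * (p * 1) ≤ (j - i : ℝ) * (p * (2 * u + 1 - j - i) / 2) := by
    apply mul_le_mul <;> nlinarith
  nlinarith

lemma le_topBound_one {p d t : ℕ} (hd : p * (t * (t - 1)) ≤ 2 * d) (ht : 2 ≤ t) :
    (p : ℝ) ≤ topBound p d t 1 := by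
  have := topBound_add_le hd zero_lt_one (by omega : 1 < t)
  rw [topBound_of_le (Nat.zero_le t)] at this
  simpa using this

lemma sum_topBound {p d t : ℕ} (ht : 0 < t) :
    ∑ l ∈ range t, topBound p d t l = (t - 1) * d / 2 + p * t * (t ^ 2 - 1) / 12 := by
  have ht' : (t : ℝ) ≠ 0 := by exact_mod_cast ht.ne'
  have h : ∀ i : ℕ, i ≤ t → ∑ l ∈ range i, topBound p d t l =
      i * (i - 1) / 2 * d / t + p / 2 * (t * (i * (i - 1) / 2) - (i - 1) * i * (2 * i - 1) / 6) := by
    intro i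
    induction i with
    | zero => intro _; simp
    | succ i ih =>
      intro hi
      rw [Finset.sum_range_succ, ih (by omega), topBound_of_le (by omega)]
      push_cast
      field_simp
      ring
  rw [h t le_rfl]
  field_simp
  ring

lemma zeroSumsFrom_of_potential {ι : Type*} [DecidableEq ι] {p : ℕ} [Fact p.Prime]
    {w : ι → ZMod p} {S : Finset ι} {t : ℕ} (ht : 2 ≤ t)
    (hK : ∀ A : Finset (ZMod p), 0 ∉ A → (∑ x ∈ A, weightMult w S x : ℕ) ≤ topBound p #S t #A)
    (hd : p * (t * (t - 1)) ≤ 2 * #S) :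
    ∀ n s i : ℕ, 1 ≤ i → i ≤ t →
      (n : ℝ) * (p + (t - 1)) < i * s - ∑ l ∈ range i, topBound p #S t l →
      ZeroSumsFrom w S n s := by
  have hp : 0 < p := (Fact.out : p.Prime).pos
  have hp' : (0 : ℝ) < p := by exact_mod_cast hp
  have ht' : (2 : ℝ) ≤ t := by exact_mod_cast ht
  have hK1 := le_topBound_one hd ht
  have hKnn : ∀ l ≤ t, 0 ≤ topBound p #S t l := by
    intro l hl
    rw [topBound_of_le hl]
    have : (l : ℝ) ≤ t := by exact_mod_cast hl
    have : (0 : ℝ) ≤ t - l := by linarith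
    positivity
  intro n
  induction n with
  | zero =>
    intro s i hi hit hlt
    apply zeroSumsFrom_zero
    rw [Nat.pos_iff_ne_zero]
    rintro rfl
    have : 0 ≤ ∑ l ∈ range i, topBound p #S t l := Finset.sum_nonneg fun l hl =>
      hKnn l (by have := Finset.mem_range.1 hl; omega)
    simp at hlt
    linarith
  | succ n ih =>
    intro s i₀ hi₀ hit₀ hlt₀
    set f : ℕ → ℝ := fun i => i * s - ∑ l ∈ range i, topBound p #S t l with hf
    obtain ⟨i, hi, hmax⟩ := Finset.exists_max_image (Finset.Icc 1 t) f ⟨1, by simp; omega⟩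
    obtain ⟨hi1, hit⟩ := Finset.mem_Icc.1 hi
    have hlt : ((n + 1 : ℕ) : ℝ) * (p + (t - 1)) < f i :=
      hlt₀.trans_le (hmax i₀ (Finset.mem_Icc.2 ⟨hi₀, hit₀⟩))
    have hnn : (0 : ℝ) ≤ n * (p + (t - 1)) := mul_nonneg (Nat.cast_nonneg n) (by linarith)
    push_cast at hlt
    have hsub : ∀ h : ℕ, (s : ℝ) - h ≤ (s - h : ℕ) := by
      intro h
      have : s ≤ (s - h) + h := by omega
      have : (s : ℝ) ≤ (s - h : ℕ) + h := by exact_mod_cast this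
      linarith
    obtain ⟨j, rfl⟩ : ∃ j, i = j + 1 := ⟨i - 1, by omega⟩
    rcases Nat.eq_zero_or_pos j with rfl | hj
    · have hf1 : f (0 + 1) = s := by
        simp [hf, topBound_of_le]
      rw [hf1] at hlt
      refine ZeroSumsFrom.succ (K := topBound p #S t) (fun A h _ => hK A h) p hp ?_ ?_
        (ih (s - p) 1 le_rfl (by omega) ?_)
      · have : (p : ℝ) ≤ s := by linarith
        exact_mod_cast this
      · intro i' hi'
        left
        have : (1 : ℝ) ≤ i' := by exact_mod_cast hi'
        nlinarith
      · have := hsub p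
        simp [topBound_of_le]
        linarith
    · have hfj : f (j + 1) = f j + (s - topBound p #S t j) := by
        simp only [hf, Finset.sum_range_succ]; push_cast; ring
      have hjs : topBound p #S t j ≤ s := by
        have := hmax j (Finset.mem_Icc.2 ⟨hj, by omega⟩)
        linarith
      have hj' : (0 : ℝ) < j := by exact_mod_cast hj
      have hjt : (j : ℝ) + 1 ≤ t := by exact_mod_cast hit
      set r : ℝ := s - topBound p #S t j with hr
      set h : ℕ := ⌈max ((p : ℝ) / (j + 1)) ((p - r) / j)⌉₊ with hh
      have hceil := Nat.le_ceil (max ((p : ℝ) / (j + 1)) ((p - r) / j))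
      rw [← hh] at hceil
      have hpos : 0 < max ((p : ℝ) / (j + 1)) ((p - r) / j) :=
        lt_max_of_lt_left (by positivity)
      have hh1 : (p : ℝ) ≤ h * (j + 1) := by
        rw [← div_le_iff₀ (by positivity)]; exact (le_max_left _ _).trans hceil
      have hh2 : p - r ≤ h * j := by
        rw [← div_le_iff₀ hj']; exact (le_max_right _ _).trans hceil
      have hhlt := Nat.ceil_lt_add_one hpos.le
      rw [← hh] at hhlt
      have hh0 : 0 < h := Nat.ceil_pos.2 hpos
      have hrec : ∃ i', 1 ≤ i' ∧ i' ≤ t ∧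
          (n : ℝ) * (p + (t - 1)) < i' * (s - h : ℕ) - ∑ l ∈ range i', topBound p #S t l := by
        have hs := hsub h
        rcases le_total ((p : ℝ) / (j + 1)) ((p - r) / j) with hle | hle
        · rw [max_eq_right hle, ← sub_lt_iff_lt_add, lt_div_iff₀ hj'] at hhlt
          refine ⟨j, hj, by omega, ?_⟩
          have hfj' : f j = j * s - ∑ l ∈ range j, topBound p #S t l := rfl
          nlinarith
        · rw [max_eq_left hle, ← sub_lt_iff_lt_add, lt_div_iff₀ (by positivity)] at hhlt
          have : h * (j + 1) < p + (j + 1) := by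
            have : (h : ℝ) * (j + 1) < p + (j + 1) := by linarith
            exact_mod_cast this
          have : h * (j + 1) ≤ p + j := by omega
          have : (h : ℝ) * (j + 1) ≤ p + j := by exact_mod_cast this
          refine ⟨j + 1, by omega, hit, ?_⟩
          have hfj' : f (j + 1) = (j + 1 : ℕ) * s - ∑ l ∈ range (j + 1), topBound p #S t l := rfl
          push_cast at hfj' ⊢
          nlinarith
      obtain ⟨i', hi1', hit', hlt'⟩ := hrec
      refine ZeroSumsFrom.succ (K := topBound p #S t) (fun A h _ => hK A h) h hh0 ?_ ?_
        (ih (s - h) i' hi1' hit' hlt')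
      · have : topBound p #S t 1 ≤ topBound p #S t j := by
          rcases Nat.eq_or_lt_of_le (show 1 ≤ j from hj) with rfl | hj2
          · exact le_rfl
          · have := topBound_add_le hd hj2 (by omega : j < t)
            linarith
        have : (p : ℝ) ≤ s := by linarith
        exact_mod_cast this
      · intro i' hi'
        rcases lt_trichotomy i' j with hlt' | rfl | hgt
        · right
          have := topBound_add_le hd hlt' (by omega : j < t)
          have : (0 : ℝ) ≤ i' * h := by positivity
          linarith
        · right; linarith
        · left
          have : (j : ℝ) + 1 ≤ i' := by exact_mod_cast hgt
          have hnn' : (0 : ℝ) ≤ h := Nat.cast_nonneg h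
          nlinarith

lemma IsGapless.hasZeroSums {ι : Type*} [DecidableEq ι] {p : ℕ} [Fact p.Prime]
    {w : ι → ZMod p} {S : Finset ι} {κ : ZMod p} {q : ℕ} (hκ : κ ≠ 0) (hS : IsGapless w S κ q)
    {t n : ℕ} (ht : 2 ≤ t) (htq : t ≤ q) (hd : p * (t * (t - 1)) ≤ 2 * #S)
    (hn : (n : ℝ) * (p + (t - 1)) < (t + 1) * #S / 2 - p * t * (t ^ 2 - 1) / 12) :
    HasZeroSums w n S := by
  refine zeroSumsFrom_of_potential ht (fun A hA => hS.sum_le hκ (by omega) htq A hA) hd n #S t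
    (by omega) le_rfl ?_ S subset_rfl le_rfl
  rw [sum_topBound (by omega)]
  linarith

lemma ZeroSumsFrom.succ_of_topBound {ι : Type*} [DecidableEq ι] {p : ℕ} [Fact p.Prime]
    {w : ι → ZMod p} {S : Finset ι} {t : ℕ} (ht : 0 < t)
    (hK : ∀ A : Finset (ZMod p), 0 ∉ A → (∑ x ∈ A, weightMult w S x : ℕ) ≤ topBound p #S t #A)
    {n s : ℕ} (h : ℕ) (hh : 0 < h) (hp : p ≤ s)
    (hKh : ∀ i : ℕ, 0 < i → i * h < p →
      i < t ∧ (2 * i * #S + t * p * i * (t - i)) / (2 * t) + p ≤ s + i * h)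
    (hn : ZeroSumsFrom w S n (s - h)) : ZeroSumsFrom w S (n + 1) s := by
  refine ZeroSumsFrom.succ (K := fun i =>
    if i < t then ((2 * i * #S + t * p * i * (t - i)) / (2 * t) : ℕ) else #S)
    (fun A h0 _ => ?_) h hh hp (fun i hi => ?_) hn
  · split_ifs with hA
    · have h1 := hK A h0
      rw [topBound_of_le hA.le] at h1
      have ht' : (0 : ℝ) < t := by exact_mod_cast ht
      have e : (#A : ℝ) * #S / t + p * #A * (t - #A) / 2 =
          ((2 * #A * #S + t * p * #A * (t - #A : ℕ) : ℕ) : ℝ) / (2 * t) := by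
        push_cast [hA.le]
        field_simp
      rw [e, le_div_iff₀ (by positivity)] at h1
      have h2 : (∑ x ∈ A, weightMult w S x) * (2 * t) ≤ 2 * #A * #S + t * p * #A * (t - #A) := by
        exact_mod_cast h1
      exact_mod_cast (Nat.le_div_iff_mul_le (by positivity)).2 h2
    · exact_mod_cast sum_weightMult_le_card w S A
  · rcases le_or_gt p (i * h) with hle | hlt
    · left; exact_mod_cast hle
    · right
      obtain ⟨hit, hle⟩ := hKh i hi hlt
      rw [if_pos hit]
      exact_mod_cast hle

lemma ZeroSumsFrom.succ_of_max {ι : Type*} [DecidableEq ι] {p : ℕ} [Fact p.Prime]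
    {w : ι → ZMod p} {S : Finset ι} {M : ℕ} (hM : ∀ x : ZMod p, x ≠ 0 → weightMult w S x ≤ M)
    {n s : ℕ} (h : ℕ) (hh : p ≤ 2 * h) (hp : p ≤ s) (hMh : p ≤ h ∨ M + p ≤ s + h)
    (hn : ZeroSumsFrom w S n (s - h)) : ZeroSumsFrom w S (n + 1) s := by
  have hpos := (Fact.out : p.Prime).pos
  refine ZeroSumsFrom.succ (K := fun i => if i = 1 then (M : ℝ) else #S) (fun A h0 hA => ?_) h
    (by omega) hp (fun i hi => ?_) hn
  · split_ifs with h1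
    · obtain ⟨x, rfl⟩ := Finset.card_eq_one.1 h1
      rw [Finset.sum_singleton]
      exact_mod_cast hM x fun hx => h0 (by simp [hx])
    · exact_mod_cast sum_weightMult_le_card w S A
  · rcases Nat.eq_or_lt_of_le (show 1 ≤ i from hi) with rfl | hi2
    · simp only [if_true]
      refine hMh.imp (fun h => ?_) (fun h => ?_)
      · rw [Nat.cast_one, one_mul]
        exact_mod_cast h
      · rw [Nat.cast_one, one_mul]
        exact_mod_cast h
    · left
      have : p ≤ i * h := hh.trans (Nat.mul_le_mul_right _ hi2)
      exact_mod_cast this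

lemma IsGapless.weightMult_le {ι : Type*} {p : ℕ} [Fact p.Prime] {w : ι → ZMod p}
    {S : Finset ι} {κ : ZMod p} {q : ℕ} (hS : IsGapless w S κ q) (hq : 2 ≤ q) {x : ZMod p}
    (hx : x ≠ 0) : ∃ y, y ≠ x ∧ (∃ j : ℕ, y = κ ^ j * x) ∧
      weightMult w S x ≤ weightMult w S y + p ∧ weightMult w S x + weightMult w S y ≤ #S := by
  obtain ⟨x', hx', y, hy, hj, hle⟩ := hS {x} (by simp) (by simpa using hx.symm)
    (by rw [Finset.card_singleton]; omega)
  obtain rfl := Finset.mem_singleton.1 hx'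
  have hne : y ≠ x' := by simpa using hy
  refine ⟨y, hne, hj, hle, ?_⟩
  rw [← Finset.sum_pair hne.symm]
  exact sum_weightMult_le_card w S _

lemma sum_eq_sum_weightMult {ι : Type*} {p : ℕ} [NeZero p] (w : ι → ZMod p) (S : Finset ι) :
    ∑ i ∈ S, w i = ∑ x, (weightMult w S x : ZMod p) * x := by
  rw [← Finset.sum_fiberwise_of_maps_to (g := w) (t := univ) (fun _ _ => Finset.mem_univ _)]
  refine Finset.sum_congr rfl fun x _ => ?_
  rw [Finset.sum_congr rfl (g := fun _ => x) (fun i hi => (Finset.mem_filter.1 hi).2),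
    Finset.sum_const, nsmul_eq_mul]
  rfl

lemma mul_lt_mul_of_rpow_lt {p q d : ℕ} (hd : (p : ℝ) * (q : ℝ) ^ (0.8 : ℝ) < d) (a b : ℕ)
    (hb : 0 < b) (hab : a ^ 5 ≤ b ^ 5 * q ^ 4) : a * p < b * d := by
  have hq : (0 : ℝ) ≤ q := Nat.cast_nonneg q
  set c : ℝ := (q : ℝ) ^ (0.8 : ℝ) with hc
  have hc0 : 0 ≤ c := Real.rpow_nonneg hq _
  have hc5 : c ^ 5 = (q : ℝ) ^ 4 := by
    rw [hc, ← Real.rpow_natCast, ← Real.rpow_mul hq, ← Real.rpow_natCast]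
    norm_num
  have hac : (a : ℝ) ≤ b * c := by
    refine le_of_pow_le_pow_left₀ (n := 5) (by norm_num) (by positivity) ?_
    rw [mul_pow, hc5]
    exact_mod_cast hab
  have hb' : (0 : ℝ) < b := by exact_mod_cast hb
  have : (a : ℝ) * p < b * d := by
    calc (a : ℝ) * p ≤ b * c * p := by gcongr
      _ = b * (p * c) := by ring
      _ < b * d := by gcongr
  exact_mod_cast this

lemma IsGapless.hasZeroSums_two {ι : Type*} [DecidableEq ι] {p : ℕ} [Fact p.Prime]
    {w : ι → ZMod p} {S : Finset ι} {κ : ZMod p} (hp2 : p % 2 = 1) (hS : IsGapless w S κ 2)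
    (hd : 174 * p < 100 * #S) : HasZeroSums w 2 S := by
  have hp3 : 2 ≤ p := (Fact.out : p.Prime).two_le
  have hM : ∀ x : ZMod p, x ≠ 0 → weightMult w S x ≤ (#S + p) / 2 := by
    intro x hx
    obtain ⟨y, -, -, h1, h2⟩ := hS.weightMult_le le_rfl hx
    omega
  suffices ZeroSumsFrom w S 2 #S from this S subset_rfl le_rfl
  obtain ⟨h, hh⟩ : ∃ h, h = max ((p + 1) / 2) ((#S + p) / 2 + p - #S) := ⟨_, rfl⟩
  refine ZeroSumsFrom.succ_of_max hM h (by omega) (by omega) (by omega) ?_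
  refine ZeroSumsFrom.succ_of_max hM p (by omega) (by omega) (by omega) ?_
  exact zeroSumsFrom_zero w S (by omega)

lemma ZMod.pow_three_ne_one_of_add_eq_zero :
    ∀ x z : ZMod 7, x ≠ 0 → 12 * x + 5 * (z * x) = 0 → z ^ 3 ≠ 1 := by
  decide

lemma IsGapless.hasZeroSums_three {ι : Type*} [DecidableEq ι] {p : ℕ} [Fact p.Prime]
    {w : ι → ZMod p} {S : Finset ι} {κ : ZMod p} (hκ : κ ^ 3 = 1) (hp2 : p % 2 = 1)
    (hp3 : p % 3 = 1) (hw : ∑ i ∈ S, w i = 0) (hS : IsGapless w S κ 3)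
    (hd : 2408 * p < 1000 * #S) : HasZeroSums w 3 S := by
  have hp1 : 2 ≤ p := (Fact.out : p.Prime).two_le
  obtain ⟨M, hM, hM1, hM2⟩ : ∃ M, (∀ x : ZMod p, x ≠ 0 → weightMult w S x ≤ M) ∧
      M ≤ (#S + p) / 2 ∧ (p = 7 → #S = 17 → M ≤ 11) := by
    by_cases h : p = 7 ∧ #S = 17
    · obtain ⟨rfl, h17⟩ := h
      refine ⟨11, fun x hx => ?_, by omega, by simp⟩
      by_contra! hlt
      obtain ⟨y, hyx, ⟨j, hj⟩, h1, h2⟩ := hS.weightMult_le (by norm_num) hx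
      have hx12 : weightMult w S x = 12 := by omega
      have hy5 : weightMult w S y = 5 := by omega
      have hz : ∀ z ∈ univ, z ∉ ({x, y} : Finset (ZMod 7)) → (weightMult w S z : ZMod 7) * z = 0 := by
        intro z _ hz
        simp only [mem_insert, mem_singleton, not_or] at hz
        have h3 : ∑ z ∈ {z, x, y}, weightMult w S z ≤ #S := sum_weightMult_le_card w S _
        rw [Finset.sum_insert (by simp [hz]), Finset.sum_pair hyx.symm] at h3
        rw [show weightMult w S z = 0 by omega]
        simp
      rw [sum_eq_sum_weightMult, ← Finset.sum_subset (Finset.subset_univ {x, y}) hz,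
        Finset.sum_pair hyx.symm, hx12, hy5, hj] at hw
      refine ZMod.pow_three_ne_one_of_add_eq_zero x (κ ^ j) hx ?_ ?_
      · exact_mod_cast hw
      · rw [← pow_mul, mul_comm, pow_mul, hκ, one_pow]
    · refine ⟨(#S + p) / 2, fun x hx => ?_, le_rfl, fun h1 h2 => absurd ⟨h1, h2⟩ h⟩
      obtain ⟨y, -, -, h1, h2⟩ := hS.weightMult_le (by norm_num) hx
      omega
  suffices ZeroSumsFrom w S 3 #S from this S subset_rfl le_rfl
  obtain ⟨h, hh⟩ : ∃ h, h = max ((p + 1) / 2) (M + p - (#S - (p + 1) / 2)) := ⟨_, rfl⟩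
  refine ZeroSumsFrom.succ_of_max hM ((p + 1) / 2) (by omega) (by omega) (by omega) ?_
  refine ZeroSumsFrom.succ_of_max hM h (by omega) (by omega) (by omega) ?_
  refine ZeroSumsFrom.succ_of_max hM p (by omega) (by omega) (by omega) ?_
  exact zeroSumsFrom_zero w S (by omega)

lemma IsGapless.hasZeroSums_of_lt_sixty {ι : Type*} [DecidableEq ι] {p q : ℕ} [Fact p.Prime]
    (hq : q.Prime) (hq60 : q < 60) (hq5 : 5 ≤ q) (hpm : p % (2 * q) = 1) {w : ι → ZMod p}
    {S : Finset ι} {κ : ZMod p} (hκ : κ ≠ 0) (hS : IsGapless w S κ q)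
    (hd : (p : ℝ) * (q : ℝ) ^ (0.8 : ℝ) < #S) : HasZeroSums w q S := by
  have hp : p.Prime := Fact.out
  have hp2 : 2 ≤ p := hp.two_le
  have hpq : 2 * q + 1 ≤ p := by
    by_contra! hlt
    rcases Nat.lt_or_ge p (2 * q) with h | h
    · rw [Nat.mod_eq_of_lt h] at hpm; omega
    · obtain rfl : p = 2 * q := by omega
      simp at hpm
  have large : ∀ a t : ℕ, 2 ≤ t → t ≤ q → a ^ 5 ≤ 10000 ^ 5 * q ^ 4 → 5000 * (t * (t - 1)) ≤ a →
      (∀ p' d' : ℝ, p' = p → d' = #S → a * p' < 10000 * d' →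
        (q : ℝ) * (p' + (t - 1)) < (t + 1) * d' / 2 - p' * t * (t ^ 2 - 1) / 12) →
      HasZeroSums w q S := by
    intro a t ht htq ha hat hlin
    have h1 := mul_lt_mul_of_rpow_lt hd a 10000 (by norm_num) ha
    refine hS.hasZeroSums hκ ht htq ?_ (hlin p #S rfl rfl (by exact_mod_cast h1))
    have := Nat.mul_le_mul_right p hat
    have e : p * (t * (t - 1)) * 5000 = 5000 * (t * (t - 1)) * p := by ring
    omega
  have hpR : (p : ℝ) ≥ 2 * q + 1 := by exact_mod_cast hpq
  have hall : ∀ t : ℕ, 0 < t → t ≤ q → ∀ A : Finset (ZMod p), 0 ∉ A →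
      (∑ x ∈ A, weightMult w S x : ℕ) ≤ topBound p #S t #A :=
    fun t ht htq A hA => hS.sum_le hκ ht htq A hA
  interval_cases q <;> try (exfalso; revert hq; norm_num; done)
  · rcases le_or_gt 41 p with h | h
    · have hR : (41 : ℝ) ≤ p := by exact_mod_cast h
      refine large 36238 3 (by norm_num) (by norm_num) (by norm_num) (by norm_num) ?_
      intro p' d' hp' hd' hlin
      rw [← hp'] at hR
      norm_num at hlin ⊢
      linarith
    · have h1 := mul_lt_mul_of_rpow_lt hd 36238 10000 (by norm_num) (by norm_num)
      have hK := hall 3 (by norm_num) (by norm_num)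
      suffices ZeroSumsFrom w S 5 #S from this S subset_rfl le_rfl
      obtain rfl | rfl : p = 11 ∨ p = 31 := by
        have : p ≠ 21 := by rintro rfl; revert hp; norm_num
        omega
      · refine ZeroSumsFrom.succ_of_topBound (by norm_num) hK 4 (by norm_num) (by omega)
          (by intro i hi hlt; have : i < 3 := (by omega); interval_cases i <;> omega) ?_
        refine ZeroSumsFrom.succ_of_topBound (by norm_num) hK 6 (by norm_num) (by omega)
          (by intro i hi hlt; have : i < 3 := (by omega); interval_cases i <;> omega) ?_
        refine ZeroSumsFrom.succ_of_topBound (by norm_num) hK 6 (by norm_num) (by omega)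
          (by intro i hi hlt; have : i < 3 := (by omega); interval_cases i <;> omega) ?_
        refine ZeroSumsFrom.succ_of_topBound (by norm_num) hK 11 (by norm_num) (by omega)
          (by intro i hi hlt; have : i < 3 := (by omega); interval_cases i <;> omega) ?_
        refine ZeroSumsFrom.succ_of_topBound (by norm_num) hK 11 (by norm_num) (by omega)
          (by intro i hi hlt; have : i < 3 := (by omega); interval_cases i <;> omega) ?_
        exact zeroSumsFrom_zero w S (by omega)
      · refine ZeroSumsFrom.succ_of_topBound (by norm_num) hK 12 (by norm_num) (by omega)
          (by intro i hi hlt; have : i < 3 := (by omega); interval_cases i <;> omega) ?_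
        refine ZeroSumsFrom.succ_of_topBound (by norm_num) hK 16 (by norm_num) (by omega)
          (by intro i hi hlt; have : i < 3 := (by omega); interval_cases i <;> omega) ?_
        refine ZeroSumsFrom.succ_of_topBound (by norm_num) hK 16 (by norm_num) (by omega)
          (by intro i hi hlt; have : i < 3 := (by omega); interval_cases i <;> omega) ?_
        refine ZeroSumsFrom.succ_of_topBound (by norm_num) hK 30 (by norm_num) (by omega)
          (by intro i hi hlt; have : i < 3 := (by omega); interval_cases i <;> omega) ?_
        refine ZeroSumsFrom.succ_of_topBound (by norm_num) hK 31 (by norm_num) (by omega)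
          (by intro i hi hlt; have : i < 3 := (by omega); interval_cases i <;> omega) ?_
        exact zeroSumsFrom_zero w S (by omega)
  · have h : 29 ≤ p := by
      have : p ≠ 15 := by rintro rfl; revert hp; norm_num
      omega
    have hR : (29 : ℝ) ≤ p := by exact_mod_cast h
    refine large 47432 3 (by norm_num) (by norm_num) (by norm_num) (by norm_num) ?_
    intro p' d' hp' hd' hlin
    rw [← hp'] at hR
    norm_num at hlin ⊢
    linarith
  · rcases le_or_gt 45 p with h | h
    · have hR : (45 : ℝ) ≤ p := by exact_mod_cast h
      refine large 68094 4 (by norm_num) (by norm_num) (by norm_num) (by norm_num) ?_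
      intro p' d' hp' hd' hlin
      rw [← hp'] at hR
      norm_num at hlin ⊢
      linarith
    · have h1 := mul_lt_mul_of_rpow_lt hd 68094 10000 (by norm_num) (by norm_num)
      have hK := hall 4 (by norm_num) (by norm_num)
      suffices ZeroSumsFrom w S 11 #S from this S subset_rfl le_rfl
      obtain rfl : p = 23 := by omega
      refine ZeroSumsFrom.succ_of_topBound (by norm_num) hK 6 (by norm_num) (by omega)
        (by intro i hi hlt; have : i < 4 := (by omega); interval_cases i <;> omega) ?_
      refine ZeroSumsFrom.succ_of_topBound (by norm_num) hK 8 (by norm_num) (by omega)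
        (by intro i hi hlt; have : i < 4 := (by omega); interval_cases i <;> omega) ?_
      refine ZeroSumsFrom.succ_of_topBound (by norm_num) hK 8 (by norm_num) (by omega)
        (by intro i hi hlt; have : i < 4 := (by omega); interval_cases i <;> omega) ?_
      refine ZeroSumsFrom.succ_of_topBound (by norm_num) hK 8 (by norm_num) (by omega)
        (by intro i hi hlt; have : i < 4 := (by omega); interval_cases i <;> omega) ?_
      refine ZeroSumsFrom.succ_of_topBound (by norm_num) hK 10 (by norm_num) (by omega)
        (by intro i hi hlt; have : i < 4 := (by omega); interval_cases i <;> omega) ?_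
      refine ZeroSumsFrom.succ_of_topBound (by norm_num) hK 12 (by norm_num) (by omega)
        (by intro i hi hlt; have : i < 4 := (by omega); interval_cases i <;> omega) ?_
      refine ZeroSumsFrom.succ_of_topBound (by norm_num) hK 12 (by norm_num) (by omega)
        (by intro i hi hlt; have : i < 4 := (by omega); interval_cases i <;> omega) ?_
      refine ZeroSumsFrom.succ_of_topBound (by norm_num) hK 12 (by norm_num) (by omega)
        (by intro i hi hlt; have : i < 4 := (by omega); interval_cases i <;> omega) ?_
      refine ZeroSumsFrom.succ_of_topBound (by norm_num) hK 15 (by norm_num) (by omega)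
        (by intro i hi hlt; have : i < 4 := (by omega); interval_cases i <;> omega) ?_
      refine ZeroSumsFrom.succ_of_topBound (by norm_num) hK 23 (by norm_num) (by omega)
        (by intro i hi hlt; have : i < 4 := (by omega); interval_cases i <;> omega) ?_
      refine ZeroSumsFrom.succ_of_topBound (by norm_num) hK 23 (by norm_num) (by omega)
        (by intro i hi hlt; have : i < 4 := (by omega); interval_cases i <;> omega) ?_
      exact zeroSumsFrom_zero w S (by omega)
  · refine large 77831 4 (by norm_num) (by norm_num) (by norm_num) (by norm_num) ?_
    intro p' d' hp' hd' hlin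
    rw [← hp'] at hpR
    norm_num at hlin hpR ⊢
    linarith
  · refine large 96462 4 (by norm_num) (by norm_num) (by norm_num) (by norm_num) ?_
    intro p' d' hp' hd' hlin
    rw [← hp'] at hpR
    norm_num at hlin hpR ⊢
    linarith
  · refine large 105439 4 (by norm_num) (by norm_num) (by norm_num) (by norm_num) ?_
    intro p' d' hp' hd' hlin
    rw [← hp'] at hpR
    norm_num at hlin hpR ⊢
    linarith
  · refine large 122852 4 (by norm_num) (by norm_num) (by norm_num) (by norm_num) ?_
    intro p' d' hp' hd' hlin
    rw [← hp'] at hpR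
    norm_num at hlin hpR ⊢
    linarith
  · refine large 147883 5 (by norm_num) (by norm_num) (by norm_num) (by norm_num) ?_
    intro p' d' hp' hd' hlin
    rw [← hp'] at hpR
    norm_num at hlin hpR ⊢
    linarith
  · refine large 155987 5 (by norm_num) (by norm_num) (by norm_num) (by norm_num) ?_
    intro p' d' hp' hd' hlin
    rw [← hp'] at hpR
    norm_num at hlin hpR ⊢
    linarith
  · refine large 179705 5 (by norm_num) (by norm_num) (by norm_num) (by norm_num) ?_
    intro p' d' hp' hd' hlin
    rw [← hp'] at hpR
    norm_num at hlin hpR ⊢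
    linarith
  · refine large 195086 5 (by norm_num) (by norm_num) (by norm_num) (by norm_num) ?_
    intro p' d' hp' hd' hlin
    rw [← hp'] at hpR
    norm_num at hlin hpR ⊢
    linarith
  · refine large 202663 5 (by norm_num) (by norm_num) (by norm_num) (by norm_num) ?_
    intro p' d' hp' hd' hlin
    rw [← hp'] at hpR
    norm_num at hlin hpR ⊢
    linarith
  · refine large 217609 5 (by norm_num) (by norm_num) (by norm_num) (by norm_num) ?_
    intro p' d' hp' hd' hlin
    rw [← hp'] at hpR
    norm_num at hlin hpR ⊢
    linarith
  · refine large 239563 5 (by norm_num) (by norm_num) (by norm_num) (by norm_num) ?_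
    intro p' d' hp' hd' hlin
    rw [← hp'] at hpR
    norm_num at hlin hpR ⊢
    linarith
  · refine large 261024 5 (by norm_num) (by norm_num) (by norm_num) (by norm_num) ?_
    intro p' d' hp' hd' hlin
    rw [← hp'] at hpR
    norm_num at hlin hpR ⊢
    linarith

lemma IsGapless.hasZeroSums_of_ge_sixty {ι : Type*} [DecidableEq ι] {p q : ℕ} [Fact p.Prime]
    (hq61 : 61 ≤ q) (hpq : 2 * q + 1 ≤ p) {w : ι → ZMod p}
    {S : Finset ι} {κ : ZMod p} (hκ : κ ≠ 0) (hS : IsGapless w S κ q)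
    (hd : (p : ℝ) * (q : ℝ) ^ (0.8 : ℝ) < #S) : HasZeroSums w q S := by
  have hq0 : (0 : ℝ) ≤ q := Nat.cast_nonneg q
  set r : ℝ := (q : ℝ) ^ (0.2 : ℝ) with hr
  have hr0 : 0 ≤ r := Real.rpow_nonneg hq0 _
  have hr4 : (q : ℝ) ^ (0.8 : ℝ) = r ^ 4 := by
    rw [hr, ← Real.rpow_natCast, ← Real.rpow_mul hq0]; norm_num
  have hr5 : (q : ℝ) = r ^ 5 := by
    rw [hr, ← Real.rpow_natCast, ← Real.rpow_mul hq0]; norm_num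
  rw [hr4] at hd
  have hr2 : 2.27 ≤ r := by
    refine le_of_pow_le_pow_left₀ (n := 5) (by norm_num) hr0 ?_
    rw [← hr5]
    have : (61 : ℝ) ≤ q := by exact_mod_cast hq61
    norm_num
    linarith
  have hpR : 2 * r ^ 5 + 1 ≤ (p : ℝ) := by rw [← hr5]; exact_mod_cast hpq
  obtain ⟨t, ht⟩ : ∃ t, ⌈3 * r⌉₊ = t + 1 :=
    ⟨⌈3 * r⌉₊ - 1, by have : 0 < ⌈3 * r⌉₊ := Nat.ceil_pos.2 (by linarith)
                      omega⟩
  have h1 : 3 * r ≤ t + 1 := by have := Nat.le_ceil (3 * r); rw [ht] at this; exact_mod_cast this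
  have h2 : (t : ℝ) < 3 * r := by
    have := Nat.ceil_lt_add_one (show 0 ≤ 3 * r by linarith)
    rw [ht] at this; push_cast at this; linarith
  have ht5 : 5 < t := by
    have : (5 : ℝ) < t := by linarith
    exact_mod_cast this
  have hsq : (5.15 : ℝ) ≤ r ^ 2 := by nlinarith
  have hp0 : (0 : ℝ) < p := by have := pow_nonneg hr0 5; linarith
  have htt : (t : ℝ) * (t - 1) ≤ 9 * r ^ 2 - 3 * r := by
    nlinarith
  have htt2 : (t : ℝ) * (t - 1) ≤ 2 * r ^ 4 := by
    nlinarith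
  refine hS.hasZeroSums hκ (t := t) (by omega) ?_ ?_ ?_
  · have : (t : ℝ) ≤ q := by
      rw [hr5]
      nlinarith [pow_le_pow_left₀ (by norm_num) hr2 3]
    exact_mod_cast this
  · have h3 : (p : ℝ) * (t * (t - 1)) ≤ 2 * #S := by
      have := mul_le_mul_of_nonneg_left htt2 hp0.le
      linarith
    have h4 : ((t - 1 : ℕ) : ℝ) = t - 1 := by push_cast [show 1 ≤ t by omega]; ring
    rw [← h4] at h3
    exact_mod_cast h3
  · rw [hr5]
    have h3 : r ^ 5 * (t - 1) ≤ p * ((3 * r - 1) / 2) := by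
      have : r ^ 5 ≤ p / 2 := by linarith
      have h4 : (0 : ℝ) ≤ t - 1 := by
        have : (5 : ℝ) < t := by exact_mod_cast ht5
        linarith
      calc r ^ 5 * (t - 1 : ℝ) ≤ (p / 2) * (3 * r - 1) := by
            apply mul_le_mul this (by linarith) h4 (by linarith)
        _ = _ := by ring
    have h4 : (3 * r) * (r ^ 4 / 2 - (9 * r ^ 2 - 3 * r) / 12) ≤
        (t + 1) * (r ^ 4 / 2 - t * (t - 1) / 12) := by
      apply mul_le_mul h1 (by linarith) _ (by linarith)
      nlinarith
    have h5 : r ^ 5 + (3 * r - 1) / 2 < (3 * r) * (r ^ 4 / 2 - (9 * r ^ 2 - 3 * r) / 12) := by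
      have h6 : 0 ≤ r * (r ^ 2 - 5.15) * (r ^ 2 + 0.65) := by
        have : 0 ≤ r ^ 2 - 5.15 := by linarith
        positivity
      nlinarith
    have h7 := mul_lt_mul_of_pos_left (h5.trans_le h4) hp0
    have h8 : (p * r ^ 4) * (t + 1) ≤ #S * (t + 1) := by
      apply mul_le_mul_of_nonneg_right hd.le; linarith
    nlinarith

theorem IsGapless.hasZeroSums_of_rpow_lt {ι : Type*} [DecidableEq ι] {p q : ℕ} [Fact p.Prime]
    (hq : q.Prime) (hdvd : q ∣ p - 1) {w : ι → ZMod p}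
    {S : Finset ι} {κ : ZMod p} (hκ : κ ^ q = 1) (hw : ∑ i ∈ S, w i = 0) (hS : IsGapless w S κ q)
    (hd : (p : ℝ) * (q : ℝ) ^ (0.8 : ℝ) < #S) : HasZeroSums w q S := by
  have hp : p.Prime := Fact.out
  have hκ0 : κ ≠ 0 := by
    rintro rfl
    rw [zero_pow hq.ne_zero] at hκ
    exact zero_ne_one hκ
  have hp3 : p ≠ 2 := by
    rintro rfl
    exact hq.one_lt.ne' (Nat.dvd_one.1 hdvd)
  have hodd : p % 2 = 1 := (hp.eq_two_or_odd).resolve_left hp3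
  have hp2 := hp.two_le
  obtain ⟨m, hm⟩ := hdvd
  rcases hq.eq_two_or_odd with rfl | hqodd
  · have := mul_lt_mul_of_rpow_lt hd 174 100 (by norm_num) (by norm_num)
    exact hS.hasZeroSums_two hodd this
  have hpm : p % (2 * q) = 1 := by
    obtain ⟨k, rfl⟩ : ∃ k, m = 2 * k := by
      rcases Nat.even_or_odd' m with ⟨k, rfl | rfl⟩
      · exact ⟨k, rfl⟩
      · exfalso
        obtain ⟨j, rfl⟩ : ∃ j, q = 2 * j + 1 := ⟨q / 2, by omega⟩
        have : p - 1 = 2 * (2 * j * k + j + k) + 1 := by rw [hm]; ring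
        omega
    rw [show p = 1 + (2 * q) * k by rw [mul_assoc, mul_left_comm, ← hm]; omega,
      Nat.add_mul_mod_self_left, Nat.mod_eq_of_lt]
    have := hq.two_le
    omega
  have hq2 := hq.two_le
  rcases Nat.lt_or_ge q 60 with hlt | hge
  · rcases Nat.lt_or_ge q 5 with hlt5 | hge5
    · obtain rfl : q = 3 := by omega
      have := mul_lt_mul_of_rpow_lt hd 2408 1000 (by norm_num) (by norm_num)
      exact hS.hasZeroSums_three hκ hodd (by omega) hw this
    · exact hS.hasZeroSums_of_lt_sixty hq hlt hge5 hpm hκ0 hd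
  · refine hS.hasZeroSums_of_ge_sixty (by omega) ?_ hκ0 hd
    by_contra! hlt
    rcases Nat.lt_or_ge p (2 * q) with h | h
    · rw [Nat.mod_eq_of_lt h] at hpm; omega
    · obtain rfl : p = 2 * q := by omega
      simp at hpm

lemma sum_sq_lt_sum_sq_of_shift {α : Type*} [Fintype α] [DecidableEq α] {m m' : α → ℕ}
    {T U : Finset α} {p : ℕ} (hp : 0 < p) (hcard : #T = #U) (hTU : T ≠ U)
    (hm : ∀ y, m' y + (if y ∈ T then p else 0) = m y + (if y ∈ U then p else 0))
    (hgap : ∀ x ∈ T, ∀ y ∈ U, y ∉ T → m y + p < m x) : ∑ y, m' y ^ 2 < ∑ y, m y ^ 2 := by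
  obtain ⟨y₀, hy₀U, hy₀T⟩ : ∃ y ∈ U, y ∉ T := by
    by_contra! h
    exact hTU (Finset.eq_of_subset_of_card_le h hcard.le).symm
  have hTne : T.Nonempty := by
    rw [← Finset.card_pos, hcard, Finset.card_pos]
    exact ⟨y₀, hy₀U⟩
  obtain ⟨x₀, hx₀, hmin⟩ := Finset.exists_min_image T m hTne
  set c : ℤ := p ^ 2 - 2 * p * m x₀ with hc
  have hp' : (0 : ℤ) < p := by exact_mod_cast hp
  have hsum : ∑ y, ((m y : ℤ) ^ 2 + c * (if y ∈ T then 1 else 0) - c * (if y ∈ U then 1 else 0)) =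
      ∑ y, (m y : ℤ) ^ 2 := by
    rw [Finset.sum_sub_distrib, Finset.sum_add_distrib, ← Finset.mul_sum, ← Finset.mul_sum]
    simp [hcard]
  have hlt : ∑ y, (m' y : ℤ) ^ 2 < ∑ y, ((m y : ℤ) ^ 2 + c * (if y ∈ T then 1 else 0) -
      c * (if y ∈ U then 1 else 0)) := by
    have hstrict : ∀ y ∈ U, y ∉ T → (m' y : ℤ) ^ 2 < (m y : ℤ) ^ 2 - c := by
      intro y hyU hyT
      have h1 := hm y
      have h2 := hgap x₀ hx₀ y hyU hyT
      simp only [hyT, hyU, if_true, if_false, add_zero] at h1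
      have h2' : (m y : ℤ) + p < m x₀ := by exact_mod_cast h2
      rw [h1, hc]
      push_cast
      nlinarith
    apply Finset.sum_lt_sum
    · intro y _
      have h1 := hm y
      by_cases hyT : y ∈ T <;> by_cases hyU : y ∈ U
      · simp only [hyT, hyU, if_true, add_left_inj] at h1 ⊢
        simp [h1]
      · simp only [hyT, hyU, if_true, if_false, add_zero] at h1 ⊢
        have h2 := hmin y hyT
        have h2' : (m x₀ : ℤ) ≤ m y := by exact_mod_cast h2
        rw [← h1, hc] at *
        push_cast at *
        nlinarith
      · have := hstrict y hyU hyT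
        simp only [hyT, hyU, if_true, if_false]
        linarith
      · simp only [hyT, hyU, if_false, add_zero] at h1 ⊢
        simp [h1]
    · refine ⟨y₀, Finset.mem_univ _, ?_⟩
      have := hstrict y₀ hy₀U hy₀T
      simp only [hy₀T, hy₀U, if_true, if_false]
      linarith
  rw [hsum] at hlt
  exact_mod_cast hlt

lemma exists_weight_block {ι : Type*} [DecidableEq ι] {p : ℕ} (w : ι → ZMod p) (S : Finset ι)
    (T : Finset (ZMod p)) (n : ℕ) (hT : ∀ x ∈ T, n ≤ weightMult w S x) :
    ∃ I ⊆ S, ∀ x, weightMult w I x = if x ∈ T then n else 0 := by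
  have h : ∀ x, ∃ J ⊆ {i ∈ S | w i = x}, #J = if x ∈ T then n else 0 := by
    intro x
    apply Finset.exists_subset_card_eq
    split_ifs with hx
    · exact hT x hx
    · exact Nat.zero_le _
  choose J hJ hJc using h
  refine ⟨{i ∈ S | i ∈ J (w i)}, Finset.filter_subset _ _, fun x => ?_⟩
  rw [← hJc, weightMult]
  congr 1
  ext i
  simp only [mem_filter]
  constructor
  · rintro ⟨⟨-, h⟩, rfl⟩; exact h
  · intro h
    have := Finset.mem_filter.1 (hJ x h)
    exact ⟨⟨this.1, this.2 ▸ h⟩, this.2⟩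

lemma exists_pow_smul_not_mem {p : ℕ} [Fact p.Prime] {q : ℕ} (hq : q.Prime) {κ : ZMod p}
    (hκ : κ ^ q = 1) (hκ1 : κ ≠ 1) {T : Finset (ZMod p)} (hTq : #T < q) {x : ZMod p} (hx : x ≠ 0) :
    ∃ i, κ ^ i * x ∉ T := by
  by_contra! h
  have hord : orderOf κ = q := haveI := Fact.mk hq; orderOf_eq_prime hκ hκ1
  have hinj : Set.InjOn (fun i => κ ^ i * x) (range q) := by
    intro i hi j hj hij
    have h1 : κ ^ i = κ ^ j := mul_right_cancel₀ hx hij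
    rw [← hord] at hi hj
    exact pow_injOn_Iio_orderOf (by simpa using hi) (by simpa using hj) h1
  have h2 : #((range q).image fun i => κ ^ i * x) ≤ #T := by
    apply Finset.card_le_card
    intro y hy
    obtain ⟨i, -, rfl⟩ := Finset.mem_image.1 hy
    exact h i
  rw [Finset.card_image_of_injOn hinj, Finset.card_range] at h2
  omega

lemma image_pow_mul_ne {p : ℕ} [Fact p.Prime] {q : ℕ} (hq : q.Prime) {κ : ZMod p}
    (hκ : κ ^ q = 1) (hκ1 : κ ≠ 1) {T : Finset (ZMod p)} (hTq : #T < q) (hT0 : 0 ∉ T)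
    (hT : T.Nonempty) {j : ℕ} (hj : 0 < j) (hjq : j < q) : T.image (κ ^ j * ·) ≠ T := by
  intro h
  obtain ⟨x, hx⟩ := hT
  have hx0 : x ≠ 0 := by rintro rfl; exact hT0 hx
  have hord : orderOf κ = q := haveI := Fact.mk hq; orderOf_eq_prime hκ hκ1
  have hj1 : κ ^ j ≠ 1 := by
    intro h1
    have := orderOf_dvd_of_pow_eq_one h1
    rw [hord] at this
    exact absurd (Nat.le_of_dvd hj this) (by omega)
  obtain ⟨i, hi⟩ := exists_pow_smul_not_mem hq (κ := κ ^ j)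
    (by rw [← pow_mul, mul_comm, pow_mul, hκ, one_pow]) hj1 hTq hx0
  refine hi ?_
  clear hi
  induction i with
  | zero => simpa using hx
  | succ i ih =>
    rw [← h, Finset.mem_image]
    exact ⟨_, ih, by ring⟩

/-- A sequence with a gap has a zero-sum subsequence on which multiplying the weights by a
nontrivial power of `κ` strictly decreases the sum of the squares of the multiplicities. -/
lemma exists_decreasing_block {ι : Type*} [DecidableEq ι] {p : ℕ} [Fact p.Prime] {q : ℕ}
    (hq : q.Prime) {κ : ZMod p} (hκ : κ ^ q = 1) (hκ1 : κ ≠ 1) (w : ι → ZMod p) (S : Finset ι)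
    (hS : ¬ IsGapless w S κ q) :
    ∃ I ⊆ S, I.Nonempty ∧ (S \ I).Nonempty ∧ ∑ i ∈ I, w i = 0 ∧ ∀ j, 0 < j → j < q →
      ∑ x, weightMult (fun i => if i ∈ I then κ ^ j * w i else w i) S x ^ 2 <
        ∑ x, weightMult w S x ^ 2 := by
  have hp : p.Prime := Fact.out
  have hκ0 : κ ≠ 0 := by
    rintro rfl
    rw [zero_pow hq.ne_zero] at hκ
    exact zero_ne_one hκ
  simp only [IsGapless, not_forall, not_exists, not_and, not_le] at hS
  obtain ⟨T₀, ⟨x₀, hx₀⟩, hT₀0, hT₀q, hT₀⟩ := hS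
  classical
  set T : Finset (ZMod p) := {x ∈ T₀ | ∃ j : ℕ, x = κ ^ j * x₀} with hTdef
  have hx₀T : x₀ ∈ T := by rw [hTdef, mem_filter]; exact ⟨hx₀, 0, by simp⟩
  have hTT₀ : T ⊆ T₀ := Finset.filter_subset _ _
  have hT0 : 0 ∉ T := fun h => hT₀0 (hTT₀ h)
  have hTq : #T < q := (Finset.card_le_card hTT₀).trans_lt hT₀q
  have hback : ∀ x ∈ T, ∀ i : ℕ, ∃ l : ℕ, κ ^ i * x₀ = κ ^ l * x := by
    intro x hx i
    obtain ⟨j, rfl⟩ := (Finset.mem_filter.1 hx).2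
    have hle : j ≤ q * j := Nat.le_mul_of_pos_left _ hq.pos
    refine ⟨i + (q * j - j), ?_⟩
    rw [← mul_assoc, ← pow_add, show i + (q * j - j) + j = i + q * j by omega, pow_add κ i, pow_mul,
      hκ, one_pow, mul_one]
  have hgap : ∀ x ∈ T, ∀ i : ℕ, κ ^ i * x₀ ∉ T →
      weightMult w S (κ ^ i * x₀) + p < weightMult w S x := by
    intro x hx i hi
    refine hT₀ x (hTT₀ hx) _ (fun h => hi ?_) (hback x hx i)
    rw [hTdef, mem_filter]
    exact ⟨h, i, rfl⟩
  have hx₀0 : x₀ ≠ 0 := by rintro rfl; exact hT₀0 hx₀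
  obtain ⟨i₀, hi₀⟩ := exists_pow_smul_not_mem hq hκ hκ1 hTq hx₀0
  have hTp : ∀ x ∈ T, p < weightMult w S x := fun x hx =>
    (Nat.le_add_left _ _).trans_lt (hgap x hx i₀ hi₀)
  obtain ⟨I, hIS, hI⟩ := exists_weight_block w S T p fun x hx => (hTp x hx).le
  refine ⟨I, hIS, ?_, ?_, ?_, ?_⟩
  · by_contra h
    rw [Finset.not_nonempty_iff_eq_empty] at h
    have := hI x₀
    rw [if_pos hx₀T, h] at this
    exact hp.ne_zero (by simpa [weightMult] using this.symm)
  · rw [Finset.sdiff_nonempty]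
    intro hSI
    have h1 := weightMult_mono w hSI x₀
    rw [hI, if_pos hx₀T] at h1
    exact absurd (hTp x₀ hx₀T) (by omega)
  · rw [sum_eq_sum_weightMult]
    refine Finset.sum_eq_zero fun x _ => ?_
    rw [hI]
    split_ifs <;> simp
  · intro j hj hjq
    have hκj : κ ^ j ≠ 0 := pow_ne_zero _ hκ0
    have hinj : Function.Injective (κ ^ j * · : ZMod p → ZMod p) := mul_right_injective₀ hκj
    refine sum_sq_lt_sum_sq_of_shift (T := T) (U := T.image (κ ^ j * ·)) hp.pos
      (Finset.card_image_of_injective _ hinj).symm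
      (image_pow_mul_ne hq hκ hκ1 hTq hT0 ⟨x₀, hx₀T⟩ hj hjq).symm ?_ ?_
    · intro y
      have hsplit : ∀ v : ι → ZMod p, weightMult v S y = weightMult v I y +
          weightMult v (S \ I) y := by
        intro v
        unfold weightMult
        rw [← Finset.card_union_of_disjoint, ← Finset.filter_union,
          Finset.union_sdiff_of_subset hIS]
        exact Finset.disjoint_filter_filter Finset.disjoint_sdiff
      rw [hsplit, hsplit w, hI]
      have h1 : weightMult (fun i => if i ∈ I then κ ^ j * w i else w i) (S \ I) y =
          weightMult w (S \ I) y := by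
        unfold weightMult
        congr 1
        refine Finset.filter_congr fun i hi => ?_
        beta_reduce
        rw [if_neg (Finset.mem_sdiff.1 hi).2]
      have h2 : weightMult (fun i => if i ∈ I then κ ^ j * w i else w i) I y =
          if y ∈ T.image (κ ^ j * ·) then p else 0 := by
        have hz : κ ^ j * ((κ ^ j)⁻¹ * y) = y := mul_inv_cancel_left₀ hκj y
        have h3 := hI ((κ ^ j)⁻¹ * y)
        have h4 : ((κ ^ j)⁻¹ * y ∈ T) ↔ y ∈ T.image (κ ^ j * ·) := by
          conv_rhs => rw [← hz]
          exact (hinj.mem_finset_image).symm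
        simp only [h4] at h3
        rw [← h3]
        unfold weightMult
        congr 1
        refine Finset.filter_congr fun i hi => ?_
        beta_reduce
        rw [if_pos hi]
        conv_lhs => rw [← hz]
        exact hinj.eq_iff
      rw [h1, h2]
      ring
    · intro x hx y hy hyT
      obtain ⟨x', hx', rfl⟩ := Finset.mem_image.1 hy
      obtain ⟨i, rfl⟩ := (Finset.mem_filter.1 hx').2
      have e : κ ^ j * (κ ^ i * x₀) = κ ^ (j + i) * x₀ := by ring
      simp only [e] at hyT ⊢
      exact hgap x hx _ hyT

/-- The sum of the first `q` iterates of an algebra endomorphism: the trace for the cyclic group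
generated by `β` when `β ^ q = 1`. -/
noncomputable def orbitSum {A : Type*} [CommRing A] [Algebra ℂ A] (β : A →ₐ[ℂ] A) (q : ℕ) :
    A →ₗ[ℂ] A :=
  ∑ j ∈ range q, (β ^ j).toLinearMap

section orbitSum

variable {A : Type*} [CommRing A] [Algebra ℂ A] {β : A →ₐ[ℂ] A} {q : ℕ}

lemma orbitSum_apply (β : A →ₐ[ℂ] A) (q : ℕ) (f : A) :
    orbitSum β q f = ∑ j ∈ range q, (β ^ j) f := by
  simp [orbitSum]

lemma map_orbitSum (hβ : β ^ q = 1) (f : A) : β (orbitSum β q f) = orbitSum β q f := by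
  have h1 := Finset.sum_range_succ (fun j => (β ^ j) f) q
  rw [Finset.sum_range_succ'] at h1
  simp only [hβ, pow_zero, add_left_inj] at h1
  rw [orbitSum_apply, map_sum, ← h1]
  refine Finset.sum_congr rfl fun j _ => ?_
  rw [pow_succ', AlgHom.mul_apply]

lemma pow_map_orbitSum (hβ : β ^ q = 1) (f : A) (j : ℕ) :
    (β ^ j) (orbitSum β q f) = orbitSum β q f := by
  induction j with
  | zero => simp
  | succ j ih => rw [pow_succ', AlgHom.mul_apply, ih, map_orbitSum hβ]

lemma orbitSum_mul_of_orbitSum (hβ : β ^ q = 1) (f g : A) :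
    orbitSum β q (orbitSum β q f * g) = orbitSum β q f * orbitSum β q g := by
  rw [orbitSum_apply, orbitSum_apply β q g, Finset.mul_sum]
  refine Finset.sum_congr rfl fun j _ => ?_
  rw [map_mul, pow_map_orbitSum hβ]

lemma orbitSum_one : orbitSum β q (1 : A) = (q : A) := by
  rw [orbitSum_apply]; simp

/-- Noether's trick: the trace of a product of `q + 1` elements is a polynomial in the traces of
products of fewer elements. -/
lemma orbitSum_prod_mul_mem (hβ : β ^ q = 1) (hq : 0 < q) (B : Subalgebra ℂ A) (u : ℕ → A) (X : A)
    (h1 : ∀ S ⊆ range q, orbitSum β q (∏ g ∈ S, (β ^ g) (u g)) ∈ B)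
    (h2 : ∀ S ⊂ range q, orbitSum β q ((∏ g ∈ S, u g) * X) ∈ B) :
    orbitSum β q ((∏ g ∈ range q, u g) * X) ∈ B := by
  have hzero : ∀ h ∈ range q, ∏ g ∈ range q, ((β ^ (h + g)) (u g) - u g) = 0 := by
    intro h hh
    have hh := Finset.mem_range.1 hh
    refine Finset.prod_eq_zero (i := if h = 0 then 0 else q - h) ?_ ?_
    · rw [Finset.mem_range]; split_ifs <;> omega
    · split_ifs with h0
      · simp [h0]
      · rw [Nat.add_sub_cancel' hh.le, hβ]; simp
  have hexp : ∑ t ∈ (range q).powerset, (-1 : A) ^ #t *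
      orbitSum β q (∏ g ∈ range q \ t, (β ^ g) (u g)) * ∏ g ∈ t, u g = 0 := by
    rw [← Finset.sum_eq_zero hzero]
    simp only [Finset.prod_sub]
    rw [Finset.sum_comm]
    refine Finset.sum_congr rfl fun t _ => ?_
    rw [← Finset.sum_mul, ← Finset.mul_sum, orbitSum_apply]
    congr 2
    refine Finset.sum_congr rfl fun h _ => ?_
    rw [map_prod]
    refine Finset.prod_congr rfl fun g _ => ?_
    rw [pow_add, AlgHom.mul_apply]
  have htr : ∑ t ∈ (range q).powerset, (-1 : A) ^ #t *
      (orbitSum β q (∏ g ∈ range q \ t, (β ^ g) (u g)) * orbitSum β q ((∏ g ∈ t, u g) * X)) = 0 := by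
    have := congrArg (fun f => orbitSum β q (f * X)) hexp
    simp only [zero_mul, map_zero, Finset.sum_mul, map_sum] at this
    rw [← this]
    refine Finset.sum_congr rfl fun t _ => ?_
    rw [← orbitSum_mul_of_orbitSum hβ]
    rcases neg_one_pow_eq_or A #t with h | h <;> rw [h] <;> simp [mul_assoc]
  rw [← Finset.insert_erase (Finset.mem_powerset_self (range q)),
    Finset.sum_insert (Finset.notMem_erase _ _), Finset.sdiff_self, Finset.prod_empty,
    orbitSum_one] at htr
  have hmem : (-1 : A) ^ #(range q) * ((q : A) * orbitSum β q ((∏ g ∈ range q, u g) * X)) ∈ B := by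
    rw [eq_neg_of_add_eq_zero_left htr]
    refine neg_mem (sum_mem fun t ht => ?_)
    rw [Finset.mem_erase, Finset.mem_powerset] at ht
    exact mul_mem (pow_mem (neg_mem (one_mem B)) _)
      (mul_mem (h1 _ Finset.sdiff_subset) (h2 t (ht.2.ssubset_of_ne ht.1)))
  have hmem2 : (q : A) * orbitSum β q ((∏ g ∈ range q, u g) * X) ∈ B := by
    rcases neg_one_pow_eq_or A #(range q) with h | h <;> rw [h] at hmem
    · simpa using hmem
    · simpa using neg_mem hmem
  have hq' : (q : ℂ) ≠ 0 := by exact_mod_cast hq.ne'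
  have := B.smul_mem hmem2 (q : ℂ)⁻¹
  rwa [← nsmul_eq_mul, ← Nat.cast_smul_eq_nsmul ℂ, smul_smul, inv_mul_cancel₀ hq', one_smul] at this

end orbitSum

lemma prod_mem_of_graded {A ι : Type*} [CommRing A] [Algebra ℂ A] {p : ℕ}
    {P : ℕ → ZMod p → Submodule ℂ A} (hP1 : 1 ∈ P 0 0)
    (hPmul : ∀ {e e' x x' f g}, f ∈ P e x → g ∈ P e' x' → f * g ∈ P (e + e') (x + x'))
    (S : Finset ι) (z : ι → A) (e : ι → ℕ) (w : ι → ZMod p) (hz : ∀ i ∈ S, z i ∈ P (e i) (w i)) :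
    ∏ i ∈ S, z i ∈ P (∑ i ∈ S, e i) (∑ i ∈ S, w i) := by
  classical
  induction S using Finset.induction_on with
  | empty => simpa using hP1
  | insert i S hi ih =>
    rw [Finset.prod_insert hi, Finset.sum_insert hi, Finset.sum_insert hi]
    exact hPmul (hz i (Finset.mem_insert_self _ _))
      (ih fun j hj => hz j (Finset.mem_insert_of_mem hj))

lemma HasZeroSums.exists_factorization {A ι : Type*} [DecidableEq ι] [CommRing A] [Algebra ℂ A]
    {p : ℕ} {P : ℕ → ZMod p → Submodule ℂ A} (hP1 : 1 ∈ P 0 0)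
    (hPmul : ∀ {e e' x x' f g}, f ∈ P e x → g ∈ P e' x' → f * g ∈ P (e + e') (x + x'))
    {w : ι → ZMod p} {z : ι → A} (hz : ∀ i, z i ∈ P 1 (w i)) :
    ∀ (n : ℕ) (S : Finset ι), HasZeroSums w n S → ∃ (u : ℕ → A) (e : ℕ → ℕ) (X : A) (e' : ℕ),
      (∀ g < n, 0 < e g ∧ u g ∈ P (e g) 0) ∧ 0 < e' ∧ X ∈ P e' (∑ i ∈ S, w i) ∧
      ∏ i ∈ S, z i = (∏ g ∈ range n, u g) * X ∧ ∑ g ∈ range n, e g + e' = #S := by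
  have hprod : ∀ S : Finset ι, ∏ i ∈ S, z i ∈ P #S (∑ i ∈ S, w i) := by
    intro S
    simpa using prod_mem_of_graded hP1 hPmul S z (fun _ => 1) w fun i _ => hz i
  intro n
  induction n with
  | zero =>
    intro S hS
    exact ⟨fun _ => 1, fun _ => 0, ∏ i ∈ S, z i, #S, by simp, Finset.card_pos.2 hS, hprod S,
      by simp, by simp⟩
  | succ n ih =>
    rintro S ⟨I, hIS, hIne, hI, hrest⟩
    obtain ⟨u, e, X, e', hu, he', hX, hXp, hes⟩ := ih _ hrest
    refine ⟨fun | 0 => ∏ i ∈ I, z i | g + 1 => u g, fun | 0 => #I | g + 1 => e g, X, e', ?_, he',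
      ?_, ?_, ?_⟩
    · intro g hg
      cases g with
      | zero => exact ⟨hIne.card_pos, hI ▸ hprod I⟩
      | succ g => exact hu g (by omega)
    · rwa [← Finset.sum_sdiff hIS, hI, add_zero]
    · rw [Finset.prod_range_succ', ← Finset.prod_sdiff hIS, hXp]
      dsimp only
      ring
    · rw [Finset.sum_range_succ']
      dsimp only
      rw [Finset.card_sdiff_of_subset hIS] at hes
      have := Finset.card_le_card hIS
      omega

theorem orbitSum_prod_mem {A ι : Type*} [CommRing A] [Algebra ℂ A] [Fintype ι] [DecidableEq ι]
    {p q : ℕ} [Fact p.Prime] (hq : q.Prime) (hdvd : q ∣ p - 1) {κ : ZMod p} (hκ : κ ^ q = 1)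
    (hκ1 : κ ≠ 1) {β : A →ₐ[ℂ] A} (hβ : β ^ q = 1) {P : ℕ → ZMod p → Submodule ℂ A}
    (hP1 : 1 ∈ P 0 0)
    (hPmul : ∀ {e e' x x' f g}, f ∈ P e x → g ∈ P e' x' → f * g ∈ P (e + e') (x + x'))
    (hPβ : ∀ {e x f}, f ∈ P e x → β f ∈ P e (κ * x)) {B : Subalgebra ℂ A}
    (hd : (p : ℝ) * (q : ℝ) ^ (0.8 : ℝ) < Fintype.card ι)
    (hB : ∀ e < Fintype.card ι, ∀ f ∈ P e 0, orbitSum β q f ∈ B) (w : ι → ZMod p) (z : ι → A)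
    (hz : ∀ i, z i ∈ P 1 (w i)) (hw : ∑ i, w i = 0) : orbitSum β q (∏ i, z i) ∈ B := by
  have hPβj : ∀ j : ℕ, ∀ {e x f}, f ∈ P e x → (β ^ j) f ∈ P e (κ ^ j * x) := by
    intro j
    induction j with
    | zero => intro e x f hf; simpa using hf
    | succ j ih =>
      intro e x f hf
      rw [pow_succ', pow_succ', AlgHom.mul_apply, mul_assoc]
      exact hPβ (ih hf)
  induction hN : ∑ x, weightMult w univ x ^ 2 using Nat.strong_induction_on generalizing w z with
  | _ N ih =>
    subst hN
    by_cases hgap : IsGapless w univ κ q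
    · have hzs := hgap.hasZeroSums_of_rpow_lt hq hdvd hκ hw (by simpa using hd)
      obtain ⟨u, e, X, e', hu, he', hX, hXp, hes⟩ :=
        hzs.exists_factorization hP1 hPmul hz
      rw [hw] at hX
      rw [Finset.card_univ] at hes
      rw [hXp]
      refine orbitSum_prod_mul_mem hβ hq.pos B u X (fun S hS => ?_) (fun S hS => ?_)
      · have h1 := prod_mem_of_graded hP1 hPmul S (fun g => (β ^ g) (u g)) e (fun _ => 0)
          fun g hg => by simpa using hPβj g (hu g (Finset.mem_range.1 (hS hg))).2
        rw [Finset.sum_const_zero] at h1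
        refine hB _ ?_ _ h1
        have := Finset.sum_le_sum_of_subset (f := e) hS
        omega
      · have h1 := prod_mem_of_graded hP1 hPmul S u e (fun _ => 0)
          fun g hg => (hu g (Finset.mem_range.1 (hS.1 hg))).2
        rw [Finset.sum_const_zero] at h1
        have h2 := hPmul h1 hX
        rw [add_zero] at h2
        refine hB _ ?_ _ h2
        obtain ⟨g, hg, hgS⟩ := Finset.exists_of_ssubset hS
        have := Finset.sum_lt_sum_of_subset (f := e) hS.1 hg hgS
          (hu g (Finset.mem_range.1 hg)).1 (fun _ _ _ => Nat.zero_le _)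
        omega
    · obtain ⟨I, -, hIne, hIc, hI, hdec⟩ := exists_decreasing_block hq hκ hκ1 w univ hgap
      have hprod : ∀ S : Finset ι, ∏ i ∈ S, z i ∈ P #S (∑ i ∈ S, w i) := by
        intro S
        simpa using prod_mem_of_graded hP1 hPmul S z (fun _ => 1) w fun i _ => hz i
      have hIc0 : ∑ i ∈ univ \ I, w i = 0 := by
        rw [← Finset.sum_sdiff (Finset.subset_univ I), hI, add_zero] at hw
        exact hw
      have hcard := Finset.card_sdiff_add_card_eq_card (Finset.subset_univ I)
      rw [Finset.card_univ] at hcard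
      have hmem : orbitSum β q (orbitSum β q (∏ i ∈ I, z i) * ∏ i ∈ univ \ I, z i) ∈ B := by
        rw [orbitSum_mul_of_orbitSum hβ]
        have := hIne.card_pos
        have := hIc.card_pos
        exact mul_mem (hB _ (by omega) _ (hI ▸ hprod I)) (hB _ (by omega) _ (hIc0 ▸ hprod _))
      have hother : ∀ j, 0 < j → j < q →
          orbitSum β q ((β ^ j) (∏ i ∈ I, z i) * ∏ i ∈ univ \ I, z i) ∈ B := by
        intro j hj hjq
        have h1 := ih _ (hdec j hj hjq) (fun i => if i ∈ I then κ ^ j * w i else w i)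
          (fun i => if i ∈ I then (β ^ j) (z i) else z i) ?_ ?_ rfl
        · rw [← Finset.prod_sdiff (Finset.subset_univ I), mul_comm] at h1
          convert h1 using 3
          · rw [map_prod]
            exact Finset.prod_congr rfl fun i hi => (if_pos hi).symm
          · exact Finset.prod_congr rfl fun i hi => (if_neg (Finset.mem_sdiff.1 hi).2).symm
        · intro i
          split_ifs
          · exact hPβj j (hz i)
          · exact hz i
        · rw [← Finset.sum_sdiff (Finset.subset_univ I),
            Finset.sum_congr rfl fun i hi => if_neg (Finset.mem_sdiff.1 hi).2,
            Finset.sum_congr rfl fun i hi => if_pos hi, ← Finset.mul_sum, hI, hIc0]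
          simp
      obtain ⟨q', rfl⟩ : ∃ q', q = q' + 1 := ⟨q - 1, by have := hq.pos; omega⟩
      rw [orbitSum_apply β _ (∏ i ∈ I, z i), Finset.sum_range_succ', add_mul, map_add,
        Finset.sum_mul, map_sum] at hmem
      have h1 := (add_mem_cancel_left ?_).1 hmem
      · rwa [pow_zero, AlgHom.one_apply, mul_comm, Finset.prod_sdiff (Finset.subset_univ I)] at h1
      · exact sum_mem fun j hj => hother (j + 1) (by omega) (by have := Finset.mem_range.1 hj; omega)

/-- The homogeneous polynomials of degree `e` on which `α` acts as the scalar `ZMod.stdAddChar x`. -/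
noncomputable def homogeneousWeightSpace {σ : Type*} {p : ℕ} [NeZero p]
    (α : MvPolynomial σ ℂ →ₐ[ℂ] MvPolynomial σ ℂ) (e : ℕ) (x : ZMod p) :
    Submodule ℂ (MvPolynomial σ ℂ) :=
  MvPolynomial.homogeneousSubmodule σ ℂ e ⊓
    Module.End.eigenspace α.toLinearMap (ZMod.stdAddChar (N := p) x)

lemma mem_homogeneousWeightSpace {σ : Type*} {p : ℕ} [NeZero p]
    {α : MvPolynomial σ ℂ →ₐ[ℂ] MvPolynomial σ ℂ} {e : ℕ} {x : ZMod p} {f : MvPolynomial σ ℂ} :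
    f ∈ homogeneousWeightSpace α e x ↔
      f.IsHomogeneous e ∧ α f = ZMod.stdAddChar (N := p) x • f := by
  rw [homogeneousWeightSpace, Submodule.mem_inf, MvPolynomial.mem_homogeneousSubmodule,
    Module.End.mem_eigenspace_iff, AlgHom.toLinearMap_apply]

lemma one_mem_homogeneousWeightSpace {σ : Type*} {p : ℕ} [NeZero p]
    (α : MvPolynomial σ ℂ →ₐ[ℂ] MvPolynomial σ ℂ) :
    1 ∈ homogeneousWeightSpace α 0 (0 : ZMod p) := by
  rw [mem_homogeneousWeightSpace]
  exact ⟨MvPolynomial.isHomogeneous_one _ _, by simp⟩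

lemma mul_mem_homogeneousWeightSpace {σ : Type*} {p : ℕ} [NeZero p]
    {α : MvPolynomial σ ℂ →ₐ[ℂ] MvPolynomial σ ℂ} {e e' : ℕ} {x x' : ZMod p}
    {f g : MvPolynomial σ ℂ} (hf : f ∈ homogeneousWeightSpace α e x)
    (hg : g ∈ homogeneousWeightSpace α e' x') :
    f * g ∈ homogeneousWeightSpace α (e + e') (x + x') := by
  rw [mem_homogeneousWeightSpace] at *
  refine ⟨hf.1.mul hg.1, ?_⟩
  rw [map_mul, hf.2, hg.2, AddChar.map_add_eq_mul, smul_mul_smul_comm]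

lemma pow_apply_of_apply_eq_smul {A : Type*} [CommRing A] [Algebra ℂ A] {α : A →ₐ[ℂ] A} {c : ℂ}
    {f : A} (h : α f = c • f) (j : ℕ) : (α ^ j) f = c ^ j • f := by
  induction j with
  | zero => simp
  | succ j ih => rw [pow_succ', AlgHom.mul_apply, ih, map_smul, h, smul_smul, pow_succ]

lemma stdAddChar_nsmul {p : ℕ} [NeZero p] (j : ℕ) (x : ZMod p) :
    ZMod.stdAddChar (N := p) ((j : ZMod p) * x) = ZMod.stdAddChar (N := p) x ^ j := by
  rw [← nsmul_eq_mul, AddChar.map_nsmul_eq_pow]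

lemma MvPolynomial.IsHomogeneous.map_algHom {σ : Type*}
    {β : MvPolynomial σ ℂ →ₐ[ℂ] MvPolynomial σ ℂ}
    (hβ : ∀ i, (β (MvPolynomial.X i)).IsHomogeneous 1) {e : ℕ} {f : MvPolynomial σ ℂ}
    (hf : f.IsHomogeneous e) : (β f).IsHomogeneous e := by
  rw [MvPolynomial.aeval_unique β]
  simpa only [Function.comp_apply, one_mul] using hf.aeval (β ∘ MvPolynomial.X) hβ

lemma map_mem_homogeneousWeightSpace {σ : Type*} {p k : ℕ} [NeZero p]
    {α β : MvPolynomial σ ℂ →ₐ[ℂ] MvPolynomial σ ℂ}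
    (hβ : ∀ i, (β (MvPolynomial.X i)).IsHomogeneous 1) (hαβ : α * β = β * α ^ k)
    {e : ℕ} {x : ZMod p} {f : MvPolynomial σ ℂ} (hf : f ∈ homogeneousWeightSpace α e x) :
    β f ∈ homogeneousWeightSpace α e ((k : ZMod p) * x) := by
  rw [mem_homogeneousWeightSpace] at *
  refine ⟨hf.1.map_algHom hβ, ?_⟩
  rw [← AlgHom.mul_apply, hαβ, AlgHom.mul_apply, pow_apply_of_apply_eq_smul hf.2, map_smul,
    stdAddChar_nsmul]

/-- A polynomial is the sum of its projections to the eigenspaces of an automorphism of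
order `p`. -/
lemma mem_span_homogeneousWeightSpace {σ : Type*} {p : ℕ} [NeZero p]
    {α : MvPolynomial σ ℂ →ₐ[ℂ] MvPolynomial σ ℂ}
    (hα : ∀ i, (α (MvPolynomial.X i)).IsHomogeneous 1) (hαp : α ^ p = 1)
    {e : ℕ} {f : MvPolynomial σ ℂ} (hf : f.IsHomogeneous e) :
    f ∈ Submodule.span ℂ {z | ∃ x : ZMod p, z ∈ homogeneousWeightSpace α e x} := by
  set ψ := ZMod.stdAddChar (N := p) with hψ
  have hp0 : (p : ℂ) ≠ 0 := by exact_mod_cast NeZero.ne p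
  have hhom : ∀ j : ℕ, ((α ^ j) f).IsHomogeneous e := by
    intro j
    induction j with
    | zero => simpa using hf
    | succ j ih => rw [pow_succ', AlgHom.mul_apply]; exact ih.map_algHom hα
  have hsucc : ∀ j : ZMod p, α ((α ^ j.val) f) = (α ^ (j + 1).val) f := by
    intro j
    rw [← AlgHom.mul_apply, ← pow_succ', ZMod.val_add, ← pow_eq_pow_mod _ hαp, ZMod.val_one_eq_one_mod]
    conv_lhs => rw [pow_eq_pow_mod _ hαp]
    conv_rhs => rw [pow_eq_pow_mod _ hαp]
    simp
  have hproj : ∀ x : ZMod p,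
      ∑ j : ZMod p, ψ (-(j * x)) • (α ^ j.val) f ∈ homogeneousWeightSpace α e x := by
    intro x
    rw [mem_homogeneousWeightSpace]
    refine ⟨?_, ?_⟩
    · rw [← MvPolynomial.mem_homogeneousSubmodule]
      exact sum_mem fun j _ => Submodule.smul_mem _ _ (hhom _)
    · rw [map_sum, Finset.smul_sum, ← Equiv.sum_comp (Equiv.addRight (1 : ZMod p))
        fun j => ψ x • ψ (-(j * x)) • (α ^ j.val) f]
      refine Finset.sum_congr rfl fun j _ => ?_
      rw [map_smul, hsucc, smul_smul, ← AddChar.map_add_eq_mul, Equiv.coe_addRight]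
      congr 2
      ring
  have hf' : f = (p : ℂ)⁻¹ • ∑ x : ZMod p, ∑ j : ZMod p, ψ (-(j * x)) • (α ^ j.val) f := by
    rw [Finset.sum_comm]
    simp_rw [← Finset.sum_smul]
    have : ∀ j : ZMod p, ∑ x : ZMod p, ψ (-(j * x)) = if j = 0 then (p : ℂ) else 0 := by
      intro j
      have := AddChar.sum_mulShift (-j) (ZMod.isPrimitive_stdAddChar p)
      simp only [ZMod.card, neg_eq_zero, Nat.cast_ite, Nat.cast_zero] at this
      rw [← this]
      refine Finset.sum_congr rfl fun x _ => ?_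
      rw [hψ]
      congr 1
      ring
    simp_rw [this, ite_smul, zero_smul]
    rw [Finset.sum_ite_eq' Finset.univ (0 : ZMod p)]
    simp [smul_smul, hp0]
  rw [hf']
  exact Submodule.smul_mem _ _ (sum_mem fun x _ => Submodule.subset_span ⟨x, hproj x⟩)

lemma orbitSum_of_apply_eq_smul {A : Type*} [CommRing A] [Algebra ℂ A] {p : ℕ} [Fact p.Prime]
    {α : A →ₐ[ℂ] A} {x : ZMod p} {f : A} (h : α f = ZMod.stdAddChar (N := p) x • f) :
    orbitSum α p f = if x = 0 then (p : ℂ) • f else 0 := by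
  rw [orbitSum_apply]
  simp_rw [pow_apply_of_apply_eq_smul h]
  rw [← Finset.sum_smul]
  split_ifs with hx
  · simp [hx]
  · have h1 : ZMod.stdAddChar (N := p) x ≠ 1 := by
      intro h1
      rw [← AddChar.map_zero_eq_one (ZMod.stdAddChar (N := p))] at h1
      exact hx (ZMod.injective_stdAddChar h1)
    have h2 : ZMod.stdAddChar (N := p) x ^ p = 1 := by
      rw [← stdAddChar_nsmul]; simp
    have h3 := geom_sum_mul (ZMod.stdAddChar (N := p) x) p
    rw [h2, sub_self] at h3
    rw [(mul_eq_zero.1 h3).resolve_right (sub_ne_zero.2 h1), zero_smul]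

lemma mem_span_prod_homogeneousWeightSpace {σ : Type*} {p : ℕ} [NeZero p]
    {α : MvPolynomial σ ℂ →ₐ[ℂ] MvPolynomial σ ℂ}
    (hα : ∀ i, (α (MvPolynomial.X i)).IsHomogeneous 1) (hαp : α ^ p = 1)
    {e : ℕ} {f : MvPolynomial σ ℂ} (hf : f.IsHomogeneous e) :
    f ∈ Submodule.span ℂ {y | ∃ (w : Fin e → ZMod p) (z : Fin e → MvPolynomial σ ℂ),
      (∀ i, z i ∈ homogeneousWeightSpace α 1 (w i)) ∧ y = ∏ i, z i} := by
  set N : Set (MvPolynomial σ ℂ) := {z | ∃ x : ZMod p, z ∈ homogeneousWeightSpace α 1 x} with hN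
  have h1 : f ∈ Submodule.span ℂ N ^ e := by
    rw [← MvPolynomial.mem_homogeneousSubmodule, ← MvPolynomial.homogeneousSubmodule_one_pow] at hf
    have hle : MvPolynomial.homogeneousSubmodule σ ℂ 1 ≤ Submodule.span ℂ N :=
      fun g hg => mem_span_homogeneousWeightSpace hα hαp hg
    exact pow_le_pow_left' hle e hf
  rw [Submodule.span_pow] at h1
  refine Submodule.span_mono ?_ h1
  intro y hy
  obtain ⟨g, rfl⟩ := Set.mem_pow.1 hy
  choose w hw using fun i => (g i).2
  exact ⟨w, fun i => g i, hw, by rw [List.prod_ofFn]⟩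

lemma orbitSum_orbitSum_mem_adjoin {σ : Type*} {p q k D : ℕ} [Fact p.Prime] (hq : q.Prime)
    (hdvd : q ∣ p - 1) (hk : (k : ZMod p) ^ q = 1) (hk1 : (k : ZMod p) ≠ 1)
    {α β : MvPolynomial σ ℂ →ₐ[ℂ] MvPolynomial σ ℂ}
    (hα : ∀ i, (α (MvPolynomial.X i)).IsHomogeneous 1)
    (hβ : ∀ i, (β (MvPolynomial.X i)).IsHomogeneous 1) (hαp : α ^ p = 1) (hβq : β ^ q = 1)
    (hαβ : α * β = β * α ^ k) (hD : (p : ℝ) * (q : ℝ) ^ (0.8 : ℝ) < D + 1) (e : ℕ)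
    {f : MvPolynomial σ ℂ} (hf : f.IsHomogeneous e) :
    orbitSum β q (orbitSum α p f) ∈
      Algebra.adjoin ℂ {g | (α g = g ∧ β g = g) ∧ g.totalDegree ≤ D} := by
  have hhom : ∀ {γ : MvPolynomial σ ℂ →ₐ[ℂ] MvPolynomial σ ℂ}
      (_ : ∀ i, (γ (MvPolynomial.X i)).IsHomogeneous 1) (m e : ℕ) {g : MvPolynomial σ ℂ}
      (_ : g.IsHomogeneous e), (orbitSum γ m g).IsHomogeneous e := by
    intro γ hγ m e g hg
    rw [orbitSum_apply, ← MvPolynomial.mem_homogeneousSubmodule]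
    refine sum_mem fun j hj => ?_
    clear hj
    rw [MvPolynomial.mem_homogeneousSubmodule]
    induction j with
    | zero => simpa using hg
    | succ j ih => rw [pow_succ', AlgHom.mul_apply]; exact ih.map_algHom hγ
  have hfix : ∀ g, α g = g → α (orbitSum β q g) = orbitSum β q g := by
    intro g hg
    rw [orbitSum_apply, map_sum]
    refine Finset.sum_congr rfl fun j hj => ?_
    clear hj
    induction j with
    | zero => simpa using hg
    | succ j ih =>
      rw [pow_succ', AlgHom.mul_apply, ← AlgHom.mul_apply, hαβ, AlgHom.mul_apply]
      congr 1
      generalize k = m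
      induction m with
      | zero => simp
      | succ m ihm => rw [pow_succ, AlgHom.mul_apply, ih, ihm]
  induction e using Nat.strong_induction_on generalizing f with
  | _ e ih =>
    rcases le_or_gt e D with heD | heD
    · refine Algebra.subset_adjoin ⟨⟨hfix _ (map_orbitSum hαp f), map_orbitSum hβq _⟩, ?_⟩
      exact (hhom hβ q e (hhom hα p e hf)).totalDegree_le.trans heD
    · set B := Algebra.adjoin ℂ {g | (α g = g ∧ β g = g) ∧ g.totalDegree ≤ D}
      suffices hle : Submodule.span ℂ {y | ∃ (w : Fin e → ZMod p) (z : Fin e → MvPolynomial σ ℂ),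
          (∀ i, z i ∈ homogeneousWeightSpace α 1 (w i)) ∧ y = ∏ i, z i} ≤
          (Subalgebra.toSubmodule B).comap (orbitSum β q ∘ₗ orbitSum α p) from
        hle (mem_span_prod_homogeneousWeightSpace hα hαp hf)
      rw [Submodule.span_le]
      rintro _ ⟨w, z, hz, rfl⟩
      change orbitSum β q (orbitSum α p (∏ i, z i)) ∈ B
      have hprod := prod_mem_of_graded (one_mem_homogeneousWeightSpace α)
        mul_mem_homogeneousWeightSpace univ z (fun _ => 1) w fun i _ => hz i
      rw [orbitSum_of_apply_eq_smul (mem_homogeneousWeightSpace.1 hprod).2]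
      split_ifs with hw
      · rw [map_smul]
        refine B.smul_mem (orbitSum_prod_mem hq hdvd hk hk1 hβq (one_mem_homogeneousWeightSpace α)
          mul_mem_homogeneousWeightSpace (map_mem_homogeneousWeightSpace hβ hαβ) ?_ ?_ w z hz hw) _
        · have : (D : ℝ) + 1 ≤ e := by exact_mod_cast heD
          rw [Fintype.card_fin]
          linarith
        · intro e' he' g hg
          rw [Fintype.card_fin] at he'
          rw [mem_homogeneousWeightSpace] at hg
          have hmem := ih e' he' hg.1
          rw [orbitSum_of_apply_eq_smul hg.2, if_pos rfl, map_smul] at hmem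
          have hp0 : (p : ℂ) ≠ 0 := by exact_mod_cast (Fact.out : p.Prime).ne_zero
          have := B.smul_mem hmem (p : ℂ)⁻¹
          rwa [smul_smul, inv_mul_cancel₀ hp0, one_smul] at this
      · rw [map_zero]
        exact zero_mem B

/-- The invariants of a pair of linear substitutions generating a nonabelian group of order `pq`
are generated in degrees at most `p * q ^ 0.8`. -/
theorem mem_adjoin_of_invariant {σ : Type*} {p q k D : ℕ} [Fact p.Prime] (hq : q.Prime)
    (hdvd : q ∣ p - 1) (hk : (k : ZMod p) ^ q = 1) (hk1 : (k : ZMod p) ≠ 1)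
    {α β : MvPolynomial σ ℂ →ₐ[ℂ] MvPolynomial σ ℂ}
    (hα : ∀ i, (α (MvPolynomial.X i)).IsHomogeneous 1)
    (hβ : ∀ i, (β (MvPolynomial.X i)).IsHomogeneous 1) (hαp : α ^ p = 1) (hβq : β ^ q = 1)
    (hαβ : α * β = β * α ^ k) (hD : (p : ℝ) * (q : ℝ) ^ (0.8 : ℝ) < D + 1)
    {f : MvPolynomial σ ℂ} (hαf : α f = f) (hβf : β f = f) :
    f ∈ Algebra.adjoin ℂ {g | (α g = g ∧ β g = g) ∧ g.totalDegree ≤ D} := by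
  set B := Algebra.adjoin ℂ {g | (α g = g ∧ β g = g) ∧ g.totalDegree ≤ D}
  have horbit : ∀ {γ : MvPolynomial σ ℂ →ₐ[ℂ] MvPolynomial σ ℂ} (m : ℕ), γ f = f →
      orbitSum γ m f = (m : ℂ) • f := by
    intro γ m h
    rw [orbitSum_apply]
    simp_rw [pow_apply_of_apply_eq_smul ((one_smul ℂ f).symm ▸ h : γ f = (1 : ℂ) • f)]
    simp [Nat.cast_smul_eq_nsmul]
  have hmem : orbitSum β q (orbitSum α p f) ∈ B := by
    rw [← MvPolynomial.sum_homogeneousComponent f, map_sum, map_sum]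
    exact sum_mem fun e _ => orbitSum_orbitSum_mem_adjoin hq hdvd hk hk1 hα hβ hαp hβq hαβ hD e
      (MvPolynomial.homogeneousComponent_isHomogeneous e f)
  rw [horbit p hαf, map_smul, horbit q hβf, smul_smul] at hmem
  have hpq : (p * q : ℂ) ≠ 0 := by
    exact_mod_cast mul_ne_zero (Fact.out : p.Prime).ne_zero hq.ne_zero
  have := B.smul_mem hmem (p * q : ℂ)⁻¹
  rwa [smul_smul, inv_mul_cancel₀ hpq, one_smul] at this

section polySubst

variable {G : Type*} [Group G] {n : ℕ} (ρ : Representation ℂ G (Fin n → ℂ))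

lemma Representation.polySubst_X (g : G) (i : Fin n) : ρ.polySubst g (MvPolynomial.X i) =
    ∑ j, MvPolynomial.C (LinearMap.toMatrix' (ρ g) i j) * MvPolynomial.X j := by
  rw [Representation.polySubst, MvPolynomial.aeval_X]

lemma Representation.isHomogeneous_polySubst_X (g : G) (i : Fin n) :
    (ρ.polySubst g (MvPolynomial.X i)).IsHomogeneous 1 := by
  rw [ρ.polySubst_X]
  exact MvPolynomial.IsHomogeneous.sum _ _ _ fun j _ => MvPolynomial.isHomogeneous_C_mul_X _ _

lemma Representation.polySubst_one : ρ.polySubst 1 = 1 := by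
  refine MvPolynomial.algHom_ext fun i => ?_
  rw [ρ.polySubst_X, map_one, LinearMap.toMatrix'_one]
  simp [Matrix.one_apply]

lemma Representation.polySubst_mul (g h : G) :
    ρ.polySubst (g * h) = ρ.polySubst h * ρ.polySubst g := by
  refine MvPolynomial.algHom_ext fun i => ?_
  rw [AlgHom.mul_apply, ρ.polySubst_X, ρ.polySubst_X, map_mul, LinearMap.toMatrix'_mul, map_sum]
  simp_rw [map_mul, ρ.polySubst_X, Matrix.mul_apply, Finset.mul_sum, map_sum, Finset.sum_mul]
  rw [Finset.sum_comm]
  refine Finset.sum_congr rfl fun j _ => Finset.sum_congr rfl fun l _ => ?_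
  rw [← MvPolynomial.algebraMap_eq, AlgHom.commutes, map_mul, mul_assoc]

lemma Representation.polySubst_pow (g : G) (m : ℕ) : ρ.polySubst (g ^ m) = ρ.polySubst g ^ m := by
  induction m with
  | zero => simpa using ρ.polySubst_one
  | succ m ih => rw [pow_succ, polySubst_mul, ih, pow_succ']

lemma Representation.mem_invariantAlgebra {f : MvPolynomial (Fin n) ℂ} :
    f ∈ ρ.invariantAlgebra ↔ ∀ g, ρ.polySubst g f = f := by
  simp [Representation.invariantAlgebra, Algebra.mem_iInf, AlgHom.mem_equalizer]

lemma Representation.mem_invariantAlgebra_of_closure {S : Set G} (hS : Subgroup.closure S = ⊤)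
    {f : MvPolynomial (Fin n) ℂ} (hf : ∀ g ∈ S, ρ.polySubst g f = f) : f ∈ ρ.invariantAlgebra := by
  rw [ρ.mem_invariantAlgebra]
  intro g
  have hg : g ∈ Subgroup.closure S := hS ▸ Subgroup.mem_top g
  induction hg using Subgroup.closure_induction with
  | mem g hg => exact hf g hg
  | one => rw [polySubst_one, AlgHom.one_apply]
  | mul g h _ _ hg hh => rw [polySubst_mul, AlgHom.mul_apply, hg, hh]
  | inv g _ hg =>
    conv_lhs => rw [← hg]
    rw [← AlgHom.mul_apply, ← polySubst_mul, mul_inv_cancel, polySubst_one, AlgHom.one_apply]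

end polySubst

lemma exists_generators_of_nonabelian_pq {p q : ℕ} (hp : p.Prime) (hq : q.Prime)
    (hdvd : q ∣ p - 1) {G : Type*} [Group G] [Finite G] (hcard : Nat.card G = p * q)
    (hna : ¬ ∀ a b : G, a * b = b * a) :
    ∃ (a b : G) (k : ℕ), a ^ p = 1 ∧ b ^ q = 1 ∧ b * a = a ^ k * b ∧
      (k : ZMod p) ^ q = 1 ∧ (k : ZMod p) ≠ 1 ∧ Subgroup.closure {a, b} = ⊤ := by
  have := Fact.mk hp
  have := Fact.mk hq
  have hqp : q < p := by
    have := Nat.le_of_dvd (by have := hp.two_le; omega) hdvd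
    have := hp.two_le
    omega
  obtain ⟨a, ha⟩ := exists_prime_orderOf_dvd_card' (G := G) p (hcard ▸ dvd_mul_right p q)
  obtain ⟨b, hb⟩ := exists_prime_orderOf_dvd_card' (G := G) q (hcard ▸ dvd_mul_left q p)
  have hindex : (Subgroup.zpowers a).index = q := by
    have := (Subgroup.zpowers a).card_mul_index
    rw [Nat.card_zpowers, ha, hcard] at this
    exact Nat.eq_of_mul_eq_mul_left hp.pos this
  have hnormal : (Subgroup.zpowers a).Normal := by
    apply Subgroup.normal_of_index_eq_minFac_card
    rw [hindex, hcard]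
    refine le_antisymm ?_ (Nat.minFac_le_of_dvd hq.two_le (dvd_mul_left q p))
    have hne : p * q ≠ 1 := fun h => hp.one_lt.ne' (Nat.eq_one_of_mul_eq_one_right h)
    rcases (Nat.minFac_prime hne).dvd_mul.1 (Nat.minFac_dvd (p * q)) with h | h
    · rw [(Nat.prime_dvd_prime_iff_eq (Nat.minFac_prime hne) hp).1 h]; exact hqp.le
    · exact ((Nat.prime_dvd_prime_iff_eq (Nat.minFac_prime hne) hq).1 h).ge
  have htop : Subgroup.closure {a, b} = ⊤ := by
    apply Subgroup.eq_top_of_le_card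
    rw [hcard]
    have haH : a ∈ Subgroup.closure {a, b} := Subgroup.subset_closure (by simp)
    have hbH : b ∈ Subgroup.closure {a, b} := Subgroup.subset_closure (by simp)
    refine Nat.le_of_dvd Nat.card_pos (Nat.Coprime.mul_dvd_of_dvd_of_dvd
      ((Nat.coprime_primes hp hq).2 hqp.ne') ?_ ?_)
    · exact ha ▸ Subgroup.orderOf_dvd_natCard _ haH
    · exact hb ▸ Subgroup.orderOf_dvd_natCard _ hbH
  obtain ⟨k, hk⟩ : ∃ k : ℕ, a ^ k = b * a * b⁻¹ := by
    have := hnormal.conj_mem a (Subgroup.mem_zpowers a) b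
    rwa [← mem_powers_iff_mem_zpowers] at this
  have hbj : ∀ j : ℕ, b ^ j * a * (b ^ j)⁻¹ = a ^ k ^ j := by
    intro j
    induction j with
    | zero => simp
    | succ j ih =>
      calc b ^ (j + 1) * a * (b ^ (j + 1))⁻¹ = b * (b ^ j * a * (b ^ j)⁻¹) * b⁻¹ := by
            rw [pow_succ' b j, mul_inv_rev]; group
        _ = (b * a * b⁻¹) ^ k ^ j := by rw [ih, conj_pow]
        _ = a ^ k ^ (j + 1) := by rw [← hk, ← pow_mul, pow_succ']
  refine ⟨a, b, k, ha ▸ pow_orderOf_eq_one a, hb ▸ pow_orderOf_eq_one b, by rw [hk]; group, ?_, ?_,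
    htop⟩
  · have h := hbj q
    rw [← hb, pow_orderOf_eq_one, hb] at h
    have h1 : a ^ k ^ q = a ^ 1 := by rw [← h]; simp
    rw [pow_eq_pow_iff_modEq, ha, ← ZMod.natCast_eq_natCast_iff] at h1
    exact_mod_cast h1
  · intro hk1
    have h1 : a ^ k = a ^ 1 := by
      rw [pow_eq_pow_iff_modEq, ha, ← ZMod.natCast_eq_natCast_iff]
      exact_mod_cast hk1
    have hcomm : b * a = a * b := by
      rw [hk, pow_one] at h1
      exact mul_inv_eq_iff_eq_mul.1 h1
    have hc : ∀ x ∈ ({a, b} : Set G), ∀ y ∈ ({a, b} : Set G), x * y = y * x := by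
      rintro x (rfl | rfl) y (rfl | rfl) <;> simp [hcomm]
    refine hna fun x y => ?_
    have hx : x ∈ Subgroup.closure {a, b} := htop ▸ Subgroup.mem_top x
    have hy : y ∈ Subgroup.closure {a, b} := htop ▸ Subgroup.mem_top y
    have := Subgroup.isMulCommutative_closure hc
    exact congrArg Subtype.val
      (IsMulCommutative.is_comm.comm (⟨x, hx⟩ : Subgroup.closure {a, b}) ⟨y, hy⟩)

end

/-- **Lemma (q^0.8 bound).**  If `p, q` are primes with `q ∣ p - 1` and `G` is a
nonabelian group of order `p * q` (equivalently, `G` has a normal subgroup `N` of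
order `p` with `C_G(N) = N` and `G/N` cyclic of order `q`), then `β(G) ≤ p·q^0.8`. -/
theorem noetherNumber_le_of_nonabelian_pq
    (p q : ℕ) (hp : p.Prime) (hq : q.Prime) (hdvd : q ∣ p - 1)
    (G : Type) [Group G] [Finite G]
    (hcard : Nat.card G = p * q) (hna : ¬ ∀ a b : G, a * b = b * a) :
    (noetherNumber G : ℝ) ≤ (p : ℝ) * (q : ℝ) ^ (0.8 : ℝ) := by
  have hle : noetherNumber G ≤ ⌊(p : ℝ) * (q : ℝ) ^ (0.8 : ℝ)⌋₊ := by
    refine Nat.sInf_le fun n ρ => ?_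
    have := Fact.mk hp
    obtain ⟨a, b, k, hap, hbq, hab, hk, hk1, htop⟩ :=
      exists_generators_of_nonabelian_pq hp hq hdvd hcard hna
    have hinv : ∀ f, (ρ.polySubst a f = f ∧ ρ.polySubst b f = f) → f ∈ ρ.invariantAlgebra := by
      rintro f ⟨h1, h2⟩
      refine ρ.mem_invariantAlgebra_of_closure htop ?_
      rintro g (rfl | rfl) <;> assumption
    refine le_antisymm (Algebra.adjoin_le fun f hf => hf.1) fun f hf => ?_
    rw [ρ.mem_invariantAlgebra] at hf
    have hmem := mem_adjoin_of_invariant hq hdvd hk hk1 (ρ.isHomogeneous_polySubst_X a)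
      (ρ.isHomogeneous_polySubst_X b) (by rw [← ρ.polySubst_pow, hap, ρ.polySubst_one])
      (by rw [← ρ.polySubst_pow, hbq, ρ.polySubst_one])
      (by rw [← ρ.polySubst_pow, ← ρ.polySubst_mul, ← ρ.polySubst_mul, hab])
      (Nat.lt_floor_add_one _) (hf a) (hf b)
    refine Algebra.adjoin_mono ?_ hmem
    rintro g ⟨hg, hgd⟩
    exact ⟨hinv g hg, hgd⟩
  exact (Nat.cast_le.2 hle).trans (Nat.floor_le (by positivity))
end

section
/- Let p be a prime and n a divisor of p − 1, and let G be the Frobenius group of order pn, i.e., G has a normal subgroup N of order p with C_G(N) = N and G/N cyclic of order n. Suppose that n ≥ 6 and that no prime divisor of n is larger than p/√n. Then β(G) < 2p√n. -/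
/-- The number of terms of `β` when multiplicities are cut off at `h`. -/
def truncCard {p : ℕ} [NeZero p] (h : ℕ) (β : Multiset (ZMod p)) : ℕ :=
  ∑ w, min (β.count w) h

/-- The elements of multiplicity at least `h`. -/
def highSupport {p : ℕ} [NeZero p] (h : ℕ) (β : Multiset (ZMod p)) : Finset (ZMod p) :=
  {w | h ≤ β.count w}

/-- Every nonempty zero-sum part of `β` has more than `s` terms. -/
def NoShortZeroSum {p : ℕ} (s : ℕ) (β : Multiset (ZMod p)) : Prop :=
  ∀ γ ≤ β, γ ≠ 0 → γ.sum = 0 → s < γ.card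

theorem truncCard_succ_eq_add_truncCard_sub_dedup {p : ℕ} [NeZero p] (s : ℕ)
    (β : Multiset (ZMod p)) :
    truncCard (s + 1) β = β.toFinset.card + truncCard s (β - β.dedup) := by
  have h : β.toFinset.card = ∑ w, if w ∈ β then 1 else 0 := by
    rw [Finset.sum_ite, Finset.sum_const_zero, add_zero, Finset.sum_const, smul_eq_mul, mul_one]
    congr 1; ext; simp
  rw [h, truncCard, truncCard, ← Finset.sum_add_distrib]
  refine Finset.sum_congr rfl fun w _ => ?_
  rw [Multiset.count_sub, Multiset.count_dedup]
  split_ifs with hw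
  · have := Multiset.one_le_count_iff_mem.2 hw
    omega
  · simp [Multiset.count_eq_zero_of_notMem hw]

theorem truncCard_succ {p : ℕ} [NeZero p] (h : ℕ) (β : Multiset (ZMod p)) :
    truncCard (h + 1) β = truncCard h β + (highSupport (h + 1) β).card := by
  have h' : (highSupport (h + 1) β).card = ∑ w, if h + 1 ≤ β.count w then 1 else 0 := by
    rw [Finset.sum_ite, Finset.sum_const_zero, add_zero, Finset.sum_const, smul_eq_mul, mul_one]
    rfl
  rw [h', truncCard, truncCard, ← Finset.sum_add_distrib]
  refine Finset.sum_congr rfl fun w _ => ?_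
  split_ifs <;> omega

theorem card_highSupport_mul_le {p : ℕ} [NeZero p] (h : ℕ) (β : Multiset (ZMod p)) :
    (highSupport h β).card * h ≤ truncCard h β := by
  rw [← smul_eq_mul, ← Finset.sum_const, truncCard]
  refine (Finset.sum_le_sum fun w hw => ?_).trans
    (Finset.sum_le_sum_of_subset (Finset.subset_univ (highSupport h β)))
  simp only [highSupport, Finset.mem_filter] at hw
  omega

theorem truncCard_eq_card_of_forall_count_le {p : ℕ} [NeZero p] {h : ℕ} {β : Multiset (ZMod p)}
    (hβ : ∀ w, β.count w ≤ h) : truncCard h β = β.card := by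
  rw [← Multiset.sum_count_eq_card (s := Finset.univ) (m := β) (by simp), truncCard]
  exact Finset.sum_congr rfl fun w _ => by have := hβ w; omega

open scoped Pointwise in
/-- Iterated Cauchy–Davenport: sums of parts of `β` with at most `s` terms. -/
theorem exists_card_le_sums {p : ℕ} [Fact p.Prime] (s : ℕ) :
    ∀ β : Multiset (ZMod p), 0 ∉ β → ∃ Z : Finset (ZMod p),
      min p (1 + truncCard s β) ≤ Z.card ∧ ∀ z ∈ Z, ∃ γ ≤ β, γ.card ≤ s ∧ γ.sum = z := by
  induction s with
  | zero =>
    intro β _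
    refine ⟨{0}, by simp [truncCard], fun z hz => ⟨0, by simp, by simp, ?_⟩⟩
    simpa using (Finset.mem_singleton.1 hz).symm
  | succ s ih =>
    intro β hβ
    obtain ⟨Z, hZ, hZs⟩ := ih (β - β.dedup) fun h => hβ (Multiset.mem_of_le tsub_le_self h)
    have hne : Z.Nonempty := by
      rw [← Finset.card_pos]
      have := (Fact.out : p.Prime).pos
      omega
    have hcd := ZMod.cauchy_davenport Fact.out hne (Finset.insert_nonempty 0 β.toFinset)
    rw [Finset.card_insert_of_notMem (by simpa using hβ)] at hcd
    refine ⟨Z + insert 0 β.toFinset, ?_, fun z hz => ?_⟩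
    · rw [truncCard_succ_eq_add_truncCard_sub_dedup]
      omega
    · obtain ⟨y, hy, a, ha, rfl⟩ := Finset.mem_add.1 hz
      obtain ⟨γ, hγ, hc, rfl⟩ := hZs y hy
      rcases Finset.mem_insert.1 ha with rfl | ha
      · exact ⟨γ, hγ.trans tsub_le_self, by omega, by simp⟩
      · refine ⟨γ + {a}, ?_, by simpa using hc, by simp⟩
        calc γ + {a} ≤ (β - β.dedup) + β.dedup :=
              add_le_add hγ (Multiset.singleton_le.2 (by simpa using ha))
          _ = β := tsub_add_cancel_of_le (Multiset.dedup_le β)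

open scoped Pointwise in
theorem truncCard_lt_of_noShortZeroSum {p : ℕ} [Fact p.Prime] {s : ℕ} (hs : 0 < s)
    {β : Multiset (ZMod p)} (hβ : 0 ∉ β) (hshort : NoShortZeroSum s β) :
    truncCard s β < p := by
  by_contra! hp
  obtain ⟨s, rfl⟩ := Nat.exists_eq_succ_of_ne_zero hs.ne'
  rw [Nat.succ_eq_add_one, truncCard_succ_eq_add_truncCard_sub_dedup] at hp
  have hp0 := (Fact.out : p.Prime).pos
  obtain ⟨Z, hZ, hZs⟩ := exists_card_le_sums s (β - β.dedup)
    fun h => hβ (Multiset.mem_of_le tsub_le_self h)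
  have hne : Z.Nonempty := by rw [← Finset.card_pos]; omega
  have hsupp : β.toFinset.Nonempty := by
    rw [Finset.nonempty_iff_ne_empty]
    intro h
    have h0 : β = 0 := Multiset.toFinset_eq_empty.1 h
    simp [h0, truncCard] at hp
    omega
  have hcd := ZMod.cauchy_davenport Fact.out hne hsupp
  have hsp := hsupp.card_pos
  have huniv : Z + β.toFinset = Finset.univ := by
    rw [← Finset.card_eq_iff_eq_univ, ZMod.card]
    have := Finset.card_le_univ (Z + β.toFinset)
    rw [ZMod.card] at this
    omega
  obtain ⟨y, hy, a, ha, h0⟩ := Finset.mem_add.1 (huniv ▸ Finset.mem_univ (0 : ZMod p))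
  obtain ⟨γ, hγ, hc, rfl⟩ := hZs y hy
  have := hshort (γ + {a}) ?_ (by simp) (by simpa using h0)
  · simp at this
    omega
  · calc γ + {a} ≤ (β - β.dedup) + β.dedup :=
          add_le_add hγ (Multiset.singleton_le.2 (by simpa using ha))
      _ = β := tsub_add_cancel_of_le (Multiset.dedup_le β)

theorem exists_zeroSum_toFinset_eq {p : ℕ} [Fact p.Prime] {ε : Multiset (ZMod p)} (hε : 0 ∉ ε)
    (hcard : ε.toFinset.card + (p - 1) ≤ ε.card) :
    ∃ γ ≤ ε, γ.sum = 0 ∧ γ.toFinset = ε.toFinset := by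
  obtain ⟨Z, hZ, hZs⟩ := exists_card_le_sums ε.card (ε - ε.dedup)
    fun h => hε (Multiset.mem_of_le tsub_le_self h)
  have hd : ε.dedup.card = ε.toFinset.card := rfl
  rw [truncCard_eq_card_of_forall_count_le fun w => (Multiset.count_le_card _ _).trans
    (Multiset.card_le_card tsub_le_self), Multiset.card_sub (Multiset.dedup_le ε)] at hZ
  have hp0 := (Fact.out : p.Prime).pos
  have huniv : Z = Finset.univ := by
    rw [← Finset.card_eq_iff_eq_univ, ZMod.card]
    have := Finset.card_le_univ Z
    rw [ZMod.card] at this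
    omega
  obtain ⟨γ, hγ, -, hsum⟩ := hZs (-ε.dedup.sum) (huniv ▸ Finset.mem_univ _)
  have hle : γ + ε.dedup ≤ ε := by
    calc γ + ε.dedup ≤ (ε - ε.dedup) + ε.dedup := by gcongr
      _ = ε := tsub_add_cancel_of_le (Multiset.dedup_le ε)
  refine ⟨γ + ε.dedup, hle, by simp [hsum], ?_⟩
  refine Finset.Subset.antisymm (Multiset.toFinset_subset.2 (Multiset.subset_of_le hle)) ?_
  intro w hw
  simp at hw ⊢
  exact Or.inr hw

theorem exists_zeroSum_above_level {p : ℕ} [Fact p.Prime] {β : Multiset (ZMod p)} (hβ : 0 ∉ β)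
    (c : ℕ) : ∀ h : ℕ, 0 < h → (highSupport h β).card ≤ c →
      truncCard h β + c.choose 2 + c + (p - 1) ≤ β.card →
      ∃ h' > 0, ∃ γ ≤ β, γ.sum = 0 ∧ γ ≠ 0 ∧ γ.toFinset = highSupport h' β ∧
        ∀ w ∈ γ, γ.count w + h' ≤ β.count w := by
  have hp1 := (Fact.out : p.Prime).one_lt
  induction c with
  | zero =>
    intro h _ hc hle
    have hemp : highSupport h β = ∅ := by simpa using hc
    rw [truncCard_eq_card_of_forall_count_le fun w => ?_] at hle
    · omega
    · by_contra! hw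
      have : w ∈ highSupport h β := by simp [highSupport, hw.le]
      simp [hemp] at this
  | succ c ih =>
    intro h hh hc hle
    by_cases heq : highSupport (h + 1) β = highSupport h β
    · let δ : Multiset (ZMod p) := ∑ w, (min (β.count w) h) • {w}
      have hδc : ∀ w, δ.count w = min (β.count w) h := by
        intro w
        simp [δ, Multiset.count_sum', Multiset.count_singleton]
      have hδ : δ ≤ β := Multiset.le_iff_count.2 fun w => by rw [hδc]; omega
      have hδcard : δ.card = truncCard h β := by simp [δ, truncCard]
      have hcnt : ∀ w, (β - δ).count w = β.count w - h := fun w => by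
        rw [Multiset.count_sub, hδc]; omega
      have hsupp : (β - δ).toFinset = highSupport h β := by
        rw [← heq]
        ext w
        rw [Multiset.mem_toFinset, ← Multiset.one_le_count_iff_mem, hcnt]
        simp [highSupport]
        omega
      obtain ⟨γ, hγ, hsum, htf⟩ := exists_zeroSum_toFinset_eq (ε := β - δ)
        (fun h0 => hβ (Multiset.mem_of_le tsub_le_self h0)) (by
          rw [hsupp, Multiset.card_sub hδ]; omega)
      refine ⟨h, hh, γ, hγ.trans tsub_le_self, hsum, ?_, htf.trans hsupp, fun w hw => ?_⟩
      · rintro rfl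
        have : β - δ = 0 := Multiset.toFinset_eq_empty.1 (by simpa using htf.symm)
        have := congrArg Multiset.card this
        rw [Multiset.card_sub hδ, Multiset.card_zero] at this
        omega
      · have h1 := Multiset.count_le_of_le w hγ
        have h2 := Multiset.one_le_count_iff_mem.2 hw
        rw [hcnt] at h1
        omega
    · have hsub : highSupport (h + 1) β ⊆ highSupport h β := by
        intro w
        simp [highSupport]
        omega
      have hlt := Finset.card_lt_card (hsub.ssubset_of_ne heq)
      refine ih (h + 1) (by omega) (by omega) ?_
      rw [truncCard_succ]
      have := Nat.choose_succ_succ c 1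
      simp at this
      omega

/-- A concave potential: units at low levels outweigh all units at higher levels. -/
def spread {p : ℕ} [NeZero p] (D : ℕ) (β : Multiset (ZMod p)) : ℕ :=
  ∑ w, ∑ j ∈ Finset.range (β.count w), (D + 1) ^ (D - j)

theorem spread_le {p : ℕ} [NeZero p] {D : ℕ} {β : Multiset (ZMod p)} (hβ : β.card = D) :
    spread D β ≤ D * (D + 1) ^ D := by
  calc spread D β ≤ ∑ w, β.count w * (D + 1) ^ D := by
        refine Finset.sum_le_sum fun w _ => ?_
        refine (Finset.sum_le_card_nsmul _ _ ((D + 1) ^ D) fun j _ => ?_).trans (by simp)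
        exact Nat.pow_le_pow_right (by omega) (by omega)
    _ = D * (D + 1) ^ D := by
        rw [← Finset.sum_mul, Multiset.sum_count_eq_card (by simp), hβ]

theorem spread_lt {p : ℕ} [NeZero p] {D h : ℕ} {γ δ γ' : Multiset (ZMod p)}
    (hD : (γ + δ).card = D)
    (hγ : ∀ w ∈ γ, h ≤ δ.count w) {w₀ : ZMod p} (hw₀ : w₀ ∈ γ')
    (hw₀' : (γ + δ).count w₀ < h) (hγ0 : γ ≠ 0) :
    spread D (γ + δ) < spread D (γ' + δ) := by
  have hloss : spread D (γ + δ) ≤ spread D δ + γ.card * (D + 1) ^ (D - h) := by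
    rw [← Multiset.sum_count_eq_card (s := Finset.univ) (m := γ) (by simp), Finset.sum_mul,
      spread, spread, ← Finset.sum_add_distrib]
    refine Finset.sum_le_sum fun w _ => ?_
    rw [Multiset.count_add, add_comm, Finset.sum_range_add]
    refine Nat.add_le_add_left ?_ _
    by_cases hw : w ∈ γ
    · refine (Finset.sum_le_card_nsmul _ _ ((D + 1) ^ (D - h)) fun j _ => ?_).trans (by simp)
      have := hγ w hw
      exact Nat.pow_le_pow_right (by omega) (by omega)
    · simp [Multiset.count_eq_zero_of_notMem hw]
  obtain ⟨w₁, hw₁⟩ := Multiset.exists_mem_of_ne_zero hγ0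
  have hhD : h ≤ D := by
    have := hγ w₁ hw₁
    have := Multiset.count_le_card w₁ δ
    simp at hD
    omega
  have hgain : spread D δ + (D + 1) ^ (D - h + 1) ≤ spread D (γ' + δ) := by
    rw [spread, spread, ← Finset.add_sum_erase _ _ (Finset.mem_univ w₀),
      ← Finset.add_sum_erase _ _ (Finset.mem_univ w₀), add_right_comm]
    refine add_le_add ?_ (Finset.sum_le_sum fun w _ => ?_)
    · have h1 := Multiset.one_le_count_iff_mem.2 hw₀
      rw [Multiset.count_add] at hw₀' ⊢
      calc _ ≤ (∑ j ∈ Finset.range (δ.count w₀), (D + 1) ^ (D - j))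
            + (D + 1) ^ (D - δ.count w₀) := by
              refine Nat.add_le_add_left (Nat.pow_le_pow_right (by omega) (by omega)) _
        _ = ∑ j ∈ Finset.range (δ.count w₀ + 1), (D + 1) ^ (D - j) :=
              (Finset.sum_range_succ _ _).symm
        _ ≤ _ := Finset.sum_le_sum_of_subset (Finset.range_mono (by omega))
    · exact Finset.sum_le_sum_of_subset (Finset.range_mono (by simp))
  have hcard : γ.card ≤ D := by simp at hD; omega
  have : γ.card * (D + 1) ^ (D - h) < (D + 1) ^ (D - h + 1) := by
    rw [pow_succ, mul_comm]
    exact Nat.mul_lt_mul_of_pos_left (by omega) (by positivity)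
  omega

/-- A nonempty set of nonzero residues stable under a nontrivial unit contains a coset of a
subgroup of prime order, whose elements add up to zero. -/
theorem not_mapsTo_of_noShortZeroSum {p n s : ℕ} [Fact p.Prime] {β : Multiset (ZMod p)}
    (hn : n ≠ 0) (hβ : 0 ∉ β) (hshort : NoShortZeroSum s β) (hs : ∀ r : ℕ, r.Prime → r ∣ n → r ≤ s)
    {k : ZMod p} (hk : k ≠ 1) (hkn : k ^ n = 1) {S : Finset (ZMod p)} (hS : S.Nonempty)
    (hSβ : ∀ w ∈ S, w ∈ β) : ∃ w ∈ S, k * w ∉ S := by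
  by_contra! hst
  have hpow : ∀ i : ℕ, ∀ w ∈ S, k ^ i * w ∈ S := by
    intro i
    induction i with
    | zero => simp
    | succ i ih =>
      intro w hw
      rw [pow_succ', mul_assoc]
      exact hst _ (ih w hw)
  have ho : orderOf k ≠ 1 := by rwa [Ne, orderOf_eq_one_iff]
  obtain ⟨q, hq, hqk⟩ := Nat.exists_prime_and_dvd ho
  have hqn : q ∣ n := hqk.trans (orderOf_dvd_of_pow_eq_one hkn)
  have hk0 : orderOf k ≠ 0 := fun h0 =>
    hn (zero_dvd_iff.1 (h0 ▸ orderOf_dvd_of_pow_eq_one hkn))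
  set l := k ^ (orderOf k / q) with hl
  have hlq : orderOf l = q := orderOf_pow_orderOf_div hk0 hqk
  have hl1 : l ≠ 1 := by
    intro h
    rw [h, orderOf_one] at hlq
    exact hq.one_lt.ne hlq
  obtain ⟨w, hw⟩ := hS
  have hw0 : w ≠ 0 := fun h => hβ (h ▸ hSβ w hw)
  have hinj : Set.InjOn (fun i => l ^ i * w) (Finset.range q) := by
    intro i hi j hj hij
    have := mul_right_cancel₀ hw0 hij
    rw [Finset.coe_range, Set.mem_Iio] at hi hj
    exact pow_injOn_Iio_orderOf (by simpa [hlq] using hi) (by simpa [hlq] using hj) this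
  let T := (Finset.range q).image fun i => l ^ i * w
  have hsum : T.sum id = 0 := by
    rw [Finset.sum_image hinj]
    simp only [id, ← Finset.sum_mul]
    have hg := mul_geom_sum l q
    rw [← hlq, pow_orderOf_eq_one, sub_self, hlq] at hg
    rw [(mul_eq_zero.1 hg).resolve_left (sub_ne_zero.2 hl1), zero_mul]
  have hTc : T.card = q := by rw [Finset.card_image_of_injOn hinj, Finset.card_range]
  have := hshort T.val ?_ ?_ ?_
  · have h' : T.val.card = q := hTc
    have := hs q hq hqn
    omega
  · refine (Multiset.le_iff_subset T.nodup).2 fun x hx => ?_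
    obtain ⟨i, -, rfl⟩ := Finset.mem_image.1 (show x ∈ T from hx)
    rw [hl, ← pow_mul]
    exact hSβ _ (hpow _ w hw)
  · intro h
    have : T.card = 0 := by rw [Finset.card_def, h, Multiset.card_zero]
    exact hq.pos.ne' (hTc ▸ this)
  · rwa [Finset.sum, Multiset.map_id] at hsum

section WeightSystem

variable {A G : Type*} [CommRing A] [Algebra ℂ A] [Group G] {p : ℕ}

/-- The span of the products of elements of the spaces `L w`, `w` running over `β`. -/
def weightProd (L : ZMod p → Submodule ℂ A) (β : Multiset (ZMod p)) : Submodule ℂ A :=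
  (β.map L).prod

/-- The invariants lying in a positive power of the generating space `V`. -/
def positiveInvariants (α : G →* (A →ₐ[ℂ] A)) (V : Submodule ℂ A) : Set A :=
  {x | (∀ g, α g x = x) ∧ ∃ e, 0 < e ∧ x ∈ V ^ e}

/-- The ideal generated by the products of an element of `V` and an invariant of positive
degree. -/
def decomposableIdeal (α : G →* (A →ₐ[ℂ] A)) (V : Submodule ℂ A) : Ideal A :=
  Ideal.span (V : Set A) * Ideal.span (positiveInvariants α V)

/-- `G` permutes the weight spaces `L w` through the character `κ`, and the kernel of `κ` acts
on them by scalars which are characters of the weight. -/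
structure IsWeightSystem (α : G →* (A →ₐ[ℂ] A)) (κ : G →* ZMod p)
    (L : ZMod p → Submodule ℂ A) : Prop where
  map_mem : ∀ g w, ∀ x ∈ L w, α g x ∈ L (κ g * w)
  exists_addChar : ∀ h, κ h = 1 →
    ∃ ψ : AddChar (ZMod p) ℂ, ∀ w, ∀ x ∈ L w, α h x = ψ w • x

theorem weightProd_add (L : ZMod p → Submodule ℂ A) (β γ : Multiset (ZMod p)) :
    weightProd L (β + γ) = weightProd L β * weightProd L γ := by
  simp [weightProd]

theorem weightProd_le_iSup_pow (L : ZMod p → Submodule ℂ A) (β : Multiset (ZMod p)) :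
    weightProd L β ≤ (⨆ w, L w) ^ β.card := by
  induction β using Multiset.induction_on with
  | empty => simp [weightProd]
  | cons w β ih =>
    rw [Multiset.card_cons, pow_succ', weightProd, Multiset.map_cons, Multiset.prod_cons]
    exact mul_le_mul' (le_iSup L w) ih

theorem iSup_pow_le_iSup_weightProd (L : ZMod p → Submodule ℂ A) (k : ℕ) :
    (⨆ w, L w) ^ k ≤ ⨆ β : {β : Multiset (ZMod p) // β.card = k}, weightProd L β := by
  induction k with
  | zero =>
    rw [pow_zero]
    exact le_iSup_of_le ⟨0, rfl⟩ (by simp [weightProd])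
  | succ k ih =>
    rw [pow_succ']
    refine (mul_le_mul' le_rfl ih).trans ?_
    rw [Submodule.iSup_mul]
    refine iSup_le fun w => ?_
    rw [Submodule.mul_iSup]
    exact iSup_le fun β => le_iSup_of_le ⟨w ::ₘ β.1, by simp [β.2]⟩ (by simp [weightProd])

theorem mem_weightProd_induction {L : ZMod p → Submodule ℂ A}
    {C : Multiset (ZMod p) → A → Prop} (one : ∀ r : ℂ, C 0 (algebraMap ℂ A r))
    (mul : ∀ w β x y, x ∈ L w → y ∈ weightProd L β → C β y → C (w ::ₘ β) (x * y))
    (add : ∀ β x y, C β x → C β y → C β (x + y)) (β : Multiset (ZMod p)) :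
    ∀ x ∈ weightProd L β, C β x := by
  induction β using Multiset.induction_on with
  | empty =>
    intro x hx
    simp only [weightProd, Multiset.map_zero, Multiset.prod_zero, Submodule.mem_one] at hx
    obtain ⟨r, rfl⟩ := hx
    exact one r
  | cons w β ih =>
    intro x hx
    rw [weightProd, Multiset.map_cons, Multiset.prod_cons] at hx
    exact Submodule.mul_induction_on hx (fun y hy z hz => mul w β y z hy hz (ih z hz)) (add _)

variable {α : G →* (A →ₐ[ℂ] A)} {κ : G →* ZMod p} {L : ZMod p → Submodule ℂ A}

theorem IsWeightSystem.map_weightProd (h : IsWeightSystem α κ L) (g : G)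
    (β : Multiset (ZMod p)) :
    ∀ x ∈ weightProd L β, α g x ∈ weightProd L (β.map (κ g * ·)) := by
  refine mem_weightProd_induction (C := fun β x => α g x ∈ weightProd L (β.map (κ g * ·)))
    (fun r => ?_) (fun w β x y hx _ ih => ?_) (fun β x y hx hy => ?_) β
  · rw [AlgHom.commutes]
    simp only [weightProd, Multiset.map_zero, Multiset.prod_zero]
    exact Submodule.algebraMap_mem r
  · rw [map_mul, weightProd, Multiset.map_cons, Multiset.map_cons, Multiset.prod_cons]
    exact Submodule.mul_mem_mul (h.map_mem g w x hx) ih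
  · rw [map_add]
    exact add_mem hx hy

theorem map_eq_smul_of_mem_weightProd {f : A →ₐ[ℂ] A} {ψ : AddChar (ZMod p) ℂ}
    (hψ : ∀ w, ∀ x ∈ L w, f x = ψ w • x) (β : Multiset (ZMod p)) :
    ∀ x ∈ weightProd L β, f x = ψ β.sum • x := by
  refine mem_weightProd_induction (C := fun β x => f x = ψ β.sum • x)
    (fun r => ?_) (fun w β x y hx _ ih => ?_) (fun β x y hx hy => ?_) β
  · simp
  · rw [map_mul, hψ w x hx, ih, Multiset.sum_cons, AddChar.map_add_eq_mul, smul_mul_smul_comm]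
  · rw [map_add, hx, hy, smul_add]

theorem IsWeightSystem.map_eq_self (h : IsWeightSystem α κ L) {g : G} (hg : κ g = 1)
    {β : Multiset (ZMod p)} (hβ : β.sum = 0) {x : A} (hx : x ∈ weightProd L β) :
    α g x = x := by
  obtain ⟨ψ, hψ⟩ := h.exists_addChar g hg
  rw [map_eq_smul_of_mem_weightProd hψ β x hx, hβ, AddChar.map_zero_eq_one, one_smul]

theorem pow_subset_span {V : Submodule ℂ A} {e : ℕ} (he : 0 < e) {x : A} (hx : x ∈ V ^ e) :
    x ∈ Ideal.span (V : Set A) := by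
  obtain ⟨e, rfl⟩ := Nat.exists_eq_succ_of_ne_zero he.ne'
  rw [Nat.succ_eq_add_one, pow_succ] at hx
  refine Submodule.mul_induction_on hx (fun y _ z hz => ?_) (fun y z => add_mem)
  exact Ideal.mul_mem_left _ _ (Ideal.subset_span hz)

theorem mul_mem_decomposableIdeal {V : Submodule ℂ A} {x y : A}
    (hx : x ∈ positiveInvariants α V) {e : ℕ} (he : 0 < e) (hy : y ∈ V ^ e) :
    x * y ∈ decomposableIdeal α V := by
  rw [mul_comm]
  exact Ideal.mul_mem_mul (pow_subset_span he hy) (Ideal.subset_span hx)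

theorem map_mem_pow {f : A →ₐ[ℂ] A} {V : Submodule ℂ A} (hV : ∀ x ∈ V, f x ∈ V) (e : ℕ) :
    ∀ x ∈ V ^ e, f x ∈ V ^ e := by
  intro x hx
  have h : (V ^ e).map f.toLinearMap ≤ V ^ e := by
    rw [Submodule.map_pow]
    exact pow_le_pow_left' (Submodule.map_le_iff_le_comap.2 hV) e
  exact h (Submodule.mem_map_of_mem hx)

theorem prod_mem_pow_sum {ι : Type*} {V : Submodule ℂ A} (S : Finset ι) (e : ι → ℕ) (u : ι → A)
    (hu : ∀ i ∈ S, u i ∈ V ^ e i) : ∏ i ∈ S, u i ∈ V ^ ∑ i ∈ S, e i := by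
  classical
  induction S using Finset.induction_on with
  | empty => simpa using ⟨1, map_one (algebraMap ℂ A)⟩
  | insert i S hi ih =>
    rw [Finset.prod_insert hi, Finset.sum_insert hi, pow_add]
    exact Submodule.mul_mem_mul (hu i (Finset.mem_insert_self i S))
      (ih fun j hj => hu j (Finset.mem_insert_of_mem hj))

theorem map_sum_univ [Fintype G] (g : G) (x : G → A) (hx : ∀ h, α g (x h) = x (g * h)) :
    α g (∑ h, x h) = ∑ h, x h := by
  rw [map_sum]
  simp only [hx]
  exact Fintype.sum_equiv (Equiv.mulLeft g) _ _ fun _ => rfl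

/-- A product of `|G/N|` invariants of `N` of positive degree lies in the ideal generated by the
invariants of `G` of positive degree. -/
theorem prod_mul_mem_decomposableIdeal [Finite G] {V : Submodule ℂ A}
    (hV : ∀ g, ∀ x ∈ V, α g x ∈ V) (N : Subgroup G) [Fintype (G ⧸ N)]
    (u : G ⧸ N → A) (e : G ⧸ N → ℕ) (hfix : ∀ q, ∀ h ∈ N, α h (u q) = u q)
    (he : ∀ q, 0 < e q) (hu : ∀ q, u q ∈ V ^ e q) {v : A} {d : ℕ} (hd : 0 < d)
    (hv : v ∈ V ^ d) : (∏ q, u q) * v ∈ decomposableIdeal α V := by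
  classical
  have := Fintype.ofFinite G
  have hzero : ∀ h : G, ∏ q, (u q - α (h * q.out) (u q)) = 0 := by
    intro h
    refine Finset.prod_eq_zero (Finset.mem_univ ((h⁻¹ : G) : G ⧸ N)) ?_
    rw [hfix, sub_self]
    obtain ⟨m, hm⟩ := QuotientGroup.mk_out_eq_mul N h⁻¹
    rw [hm]
    simp
  have hsum : ∑ h : G, ∏ q, (u q - α (h * q.out) (u q)) = 0 :=
    Finset.sum_eq_zero fun h _ => hzero h
  simp only [Finset.prod_sub] at hsum
  rw [Finset.sum_comm, ← Finset.add_sum_erase _ _ (Finset.empty_mem_powerset _)] at hsum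
  simp only [Finset.card_empty, pow_zero, one_mul, Finset.sdiff_empty, Finset.prod_empty, mul_one,
    Finset.sum_const, ← Finset.mul_sum] at hsum
  have hmem : ((Finset.univ : Finset G).card • ∏ q, u q) * v ∈ decomposableIdeal α V := by
    rw [eq_neg_of_add_eq_zero_left hsum, neg_mul, neg_mem_iff, Finset.sum_mul]
    refine sum_mem fun S hS => ?_
    rw [mul_assoc]
    refine Ideal.mul_mem_left _ _ (mul_mem_decomposableIdeal ⟨fun g => ?_, ?_⟩ hd hv)
    · refine map_sum_univ g _ fun h => ?_
      rw [map_prod]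
      refine Finset.prod_congr rfl fun q _ => ?_
      rw [mul_assoc, map_mul α g]
      rfl
    · refine ⟨∑ q ∈ S, e q, Finset.sum_pos (fun q _ => he q) ?_, sum_mem fun h _ => ?_⟩
      · exact Finset.nonempty_iff_ne_empty.2 (Finset.ne_of_mem_erase hS)
      · exact prod_mem_pow_sum S e _ fun q _ => map_mem_pow (hV _) _ _ (hu q)
  have hne : ((Finset.univ : Finset G).card : ℂ) ≠ 0 :=
    Nat.cast_ne_zero.2 (Finset.card_ne_zero.2 Finset.univ_nonempty)
  rw [← Nat.cast_smul_eq_nsmul ℂ, smul_mul_assoc] at hmem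
  exact ((decomposableIdeal α V).restrictScalars ℂ).smul_mem_iff hne |>.1 hmem

theorem IsWeightSystem.map_iSup (h : IsWeightSystem α κ L) (g : G) :
    ∀ x ∈ ⨆ w, L w, α g x ∈ ⨆ w, L w := by
  have : ⨆ w, L w ≤ (⨆ w, L w).comap (α g).toLinearMap :=
    iSup_le fun w x hx => Submodule.mem_iSup_of_mem (κ g * w) (h.map_mem g w x hx)
  exact fun x hx => this hx

/-- Modulo decomposable elements, a zero-sum factor may be replaced by its translates under the
elements acting nontrivially on the weights. -/
theorem IsWeightSystem.mul_mem_of_translates [Finite G] (h : IsWeightSystem α κ L)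
    {γ : Multiset (ZMod p)} (hγ : γ.sum = 0) (hγ0 : γ ≠ 0) {u v : A} (hu : u ∈ weightProd L γ)
    {d : ℕ} (hd : 0 < d) (hv : v ∈ (⨆ w, L w) ^ d) {W : Submodule ℂ A}
    (hI : ∀ x ∈ decomposableIdeal α (⨆ w, L w), x ∈ W)
    (htr : ∀ g, κ g ≠ 1 → α g u * v ∈ W) : u * v ∈ W := by
  classical
  have := Fintype.ofFinite G
  have hV : ∀ g, α g u ∈ (⨆ w, L w) ^ γ.card := fun g =>
    map_mem_pow (h.map_iSup g) _ _ (weightProd_le_iSup_pow L γ hu)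
  have hinv : (∑ g, α g u) * v ∈ W := by
    refine hI _ (mul_mem_decomposableIdeal ⟨fun g => map_sum_univ g _ fun g' => ?_,
      γ.card, Multiset.card_pos.2 hγ0, sum_mem fun g _ => hV g⟩ hd hv)
    rw [map_mul]
    rfl
  rw [← Finset.sum_filter_add_sum_filter_not Finset.univ (fun g => κ g = 1), add_mul] at hinv
  have hrest : (∑ g with ¬ κ g = 1, α g u) * v ∈ W := by
    rw [Finset.sum_mul]
    exact sum_mem fun g hg => htr g (Finset.mem_filter.1 hg).2
  have hmain := (Submodule.add_mem_iff_left W hrest).1 hinv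
  rw [Finset.sum_congr rfl fun g hg => h.map_eq_self (Finset.mem_filter.1 hg).2 hγ hu,
    Finset.sum_const, ← Nat.cast_smul_eq_nsmul ℂ, smul_mul_assoc] at hmain
  refine (W.smul_mem_iff (Nat.cast_ne_zero.2 (Finset.card_ne_zero.2 ⟨1, ?_⟩))).1 hmain
  simp

/-- Long zero-sum weight products are, modulo decomposable elements, combinations of products
with a short zero-sum factor. -/
theorem IsWeightSystem.weightProd_le [Fact p.Prime] [Finite G] (h : IsWeightSystem α κ L)
    {n s : ℕ} (hn : n ≠ 0) (hκ : ∀ g, κ g ^ n = 1) (hs : 0 < s)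
    (hsmall : ∀ r : ℕ, r.Prime → r ∣ n → r ≤ s) {D : ℕ}
    (hD : 2 * (p - 1) + ((p - 1) / s).choose 2 + (p - 1) / s ≤ D) {W : Submodule ℂ A}
    (hI : ∀ x ∈ decomposableIdeal α (⨆ w, L w), x ∈ W)
    (hW : ∀ γ δ : Multiset (ZMod p), γ.sum = 0 → δ.sum = 0 → γ ≠ 0 → γ.card ≤ s →
      γ.card + δ.card = D → weightProd L γ * weightProd L δ ≤ W)
    (β : Multiset (ZMod p)) (hβ : β.sum = 0) (hβD : β.card = D) : weightProd L β ≤ W := by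
  classical
  obtain ⟨m, hm⟩ : ∃ m, m = D * (D + 1) ^ D - spread D β := ⟨_, rfl⟩
  induction m using Nat.strong_induction_on generalizing β with
  | _ m ih =>
  by_cases hshort : NoShortZeroSum s β
  swap
  · simp only [NoShortZeroSum, not_forall, not_lt] at hshort
    obtain ⟨γ, hγ, hγ0, hγs, hγc⟩ := hshort
    obtain ⟨δ, rfl⟩ := Multiset.le_iff_exists_add.1 hγ
    rw [weightProd_add]
    exact hW γ δ hγs (by simpa [hγs] using hβ) hγ0 hγc (by simpa using hβD)
  have h0 : 0 ∉ β := fun h0 => by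
    have := hshort {0} (Multiset.singleton_le.2 h0) (by simp) (by simp)
    simp at this
    omega
  have hp := (Fact.out : p.Prime).one_lt
  have htr := truncCard_lt_of_noShortZeroSum hs h0 hshort
  have hhigh := (Nat.le_div_iff_mul_le hs).2
    ((card_highSupport_mul_le s β).trans (Nat.le_sub_one_of_lt htr))
  obtain ⟨l, hl, γ, hγ, hγs, hγ0, htf, hcnt⟩ :=
    exists_zeroSum_above_level h0 _ s hs hhigh (by omega)
  obtain ⟨δ, rfl⟩ := Multiset.le_iff_exists_add.1 hγ
  have hδs : δ.sum = 0 := by simpa [hγs] using hβ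
  have hcnt' : ∀ w ∈ γ, l ≤ δ.count w := fun w hw => by
    have := hcnt w hw
    rw [Multiset.count_add] at this
    omega
  obtain ⟨w₁, hw₁⟩ := Multiset.exists_mem_of_ne_zero hγ0
  have hδ : 0 < δ.card := by
    have := hcnt' w₁ hw₁
    have := Multiset.count_le_card w₁ δ
    omega
  rw [weightProd_add]
  refine Submodule.mul_le.2 fun u hu v hv => ?_
  refine h.mul_mem_of_translates hγs hγ0 hu hδ (weightProd_le_iSup_pow L δ hv) hI fun g hg => ?_
  obtain ⟨w, hw, hgw⟩ := not_mapsTo_of_noShortZeroSum hn h0 hshort hsmall hg (hκ g)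
    (S := γ.toFinset) ⟨w₁, by simpa using hw₁⟩ (fun w hw => Multiset.mem_of_le hγ (by simpa using hw))
  rw [Multiset.mem_toFinset] at hw
  have hlt := spread_lt hβD hcnt' (Multiset.mem_map_of_mem (κ g * ·) hw)
    (by simpa [htf, highSupport] using hgw) hγ0
  have hcard : (γ.map (κ g * ·) + δ).card = D := by simpa using hβD
  have hle := spread_le hcard
  refine ih _ (by omega) (γ.map (κ g * ·) + δ) ?_ hcard rfl ?_
  · rw [Multiset.sum_add, Multiset.sum_map_mul_left, Multiset.map_id', hγs, hδs]
    simp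
  · rw [weightProd_add]
    exact Submodule.mul_mem_mul (h.map_weightProd g γ u hu) hv

theorem IsWeightSystem.prod_mul_mem_decomposableIdeal [Fact p.Prime] [Finite G]
    (h : IsWeightSystem α κ L) {n s : ℕ} (hn : Nat.card (G ⧸ κ.ker) = n)
    (hκ : ∀ g, κ g ^ n = 1) (hs : 0 < s) (hsmall : ∀ r : ℕ, r.Prime → r ∣ n → r ≤ s) {d : ℕ}
    (hsd : s < d) (hd : 2 * (p - 1) + ((p - 1) / s).choose 2 + (p - 1) / s ≤ d) (i : ℕ) :
    ∀ U : Multiset A, U.card + i = n →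
      (∀ x ∈ U, ∃ γ : Multiset (ZMod p), γ.sum = 0 ∧ γ ≠ 0 ∧ x ∈ weightProd L γ) →
      ∀ β : Multiset (ZMod p), β.sum = 0 → d + i * s ≤ β.card + s → 0 < β.card →
      ∀ v ∈ weightProd L β, U.prod * v ∈ decomposableIdeal α (⨆ w, L w) := by
  have hfin : Finite (G ⧸ κ.ker) := inferInstance
  have hn0 : n ≠ 0 := hn ▸ Nat.card_pos.ne'
  induction i with
  | zero =>
    intro U hU hUγ β _ _ hβ v hv
    have := Fintype.ofFinite (G ⧸ κ.ker)
    let f : G ⧸ κ.ker ≃ Fin U.toList.length := Fintype.equivFinOfCardEq (by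
      rw [← Nat.card_eq_fintype_card, hn, Multiset.length_toList, ← hU, add_zero])
    have hprod : U.prod = ∏ q, U.toList.get (f q) := by
      rw [f.prod_comp U.toList.get, ← Multiset.prod_toList]
      simp [Fin.prod_univ_getElem]
    choose γ hγs hγ0 hγ using fun q => hUγ (U.toList.get (f q))
      (Multiset.mem_toList.1 (List.get_mem _ _))
    rw [hprod]
    exact _root_.prod_mul_mem_decomposableIdeal h.map_iSup κ.ker _ (fun q => (γ q).card)
      (fun q g hg => h.map_eq_self hg (hγs q) (hγ q)) (fun q => Multiset.card_pos.2 (hγ0 q))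
      (fun q => weightProd_le_iSup_pow L _ (hγ q)) hβ (weightProd_le_iSup_pow L _ hv)
  | succ i ih =>
    intro U hU hUγ β hβs hβ _ v hv
    let W : Submodule ℂ A := ((decomposableIdeal α (⨆ w, L w)).restrictScalars ℂ).comap
      (LinearMap.mulLeft ℂ U.prod)
    have hβ' : d + i * s ≤ β.card := by
      rw [add_mul, one_mul] at hβ
      omega
    refine h.weightProd_le (W := W) hn0 hκ hs hsmall (D := β.card)
      (by omega) (fun x hx => Ideal.mul_mem_left _ _ hx) ?_ β hβs rfl hv
    intro γ δ hγs hδs hγ0 hγc hc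
    refine Submodule.mul_le.2 fun x hx y hy => ?_
    have := ih (x ::ₘ U) (by rw [Multiset.card_cons]; omega) ?_ δ hδs (by omega) (by omega) y hy
    · simpa [W, mul_comm x, mul_assoc] using this
    · intro z hz
      rcases Multiset.mem_cons.1 hz with rfl | hz
      · exact ⟨γ, hγs, hγ0, hx⟩
      · exact hUγ z hz

theorem IsWeightSystem.weightProd_le_decomposableIdeal [Fact p.Prime] [Finite G]
    (h : IsWeightSystem α κ L) {n s : ℕ} (hn : Nat.card (G ⧸ κ.ker) = n)
    (hκ : ∀ g, κ g ^ n = 1) (hs : 0 < s) (hsmall : ∀ r : ℕ, r.Prime → r ∣ n → r ≤ s) {d : ℕ}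
    (hsd : s < d) (hd : 2 * (p - 1) + ((p - 1) / s).choose 2 + (p - 1) / s ≤ d)
    {β : Multiset (ZMod p)} (hβ : β.sum = 0) (hc : d + n * s ≤ β.card + s) (hc0 : 0 < β.card)
    {v : A} (hv : v ∈ weightProd L β) : v ∈ decomposableIdeal α (⨆ w, L w) := by
  simpa using h.prod_mul_mem_decomposableIdeal hn hκ hs hsmall hsd hd n 0 (by simp) (by simp)
    β hβ hc hc0 v hv

end WeightSystem

section WeightSpace

variable {A G : Type*} [CommRing A] [Algebra ℂ A] [Group G] {p : ℕ}

/-- A generator of a normal subgroup of prime order is conjugated to its powers through a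
character of the ambient group. -/
theorem exists_monoidHom_conj_eq_pow [Fact p.Prime] {c : G} (hc : orderOf c = p)
    (hnormal : (Subgroup.zpowers c).Normal) :
    ∃ κ : G →* ZMod p, ∀ g, g⁻¹ * c * g = c ^ (κ g).val := by
  have hmod : ∀ m : ℕ, c ^ (m % p) = c ^ m := fun m => by
    have := pow_mod_orderOf c m
    rwa [hc] at this
  have hex : ∀ g : G, ∃ k : ZMod p, g⁻¹ * c * g = c ^ k.val := by
    intro g
    have hfin : IsOfFinOrder c := orderOf_pos_iff.1 (hc ▸ (Fact.out : p.Prime).pos)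
    have h : g⁻¹ * c * g ∈ Subgroup.zpowers c := by
      simpa using hnormal.conj_mem c (Subgroup.mem_zpowers c) g⁻¹
    obtain ⟨k, hk⟩ := hfin.mem_powers_iff_mem_zpowers.2 h
    exact ⟨k, by rw [ZMod.val_natCast, hmod, ← hk]⟩
  have hinj : ∀ a b : ZMod p, c ^ a.val = c ^ b.val → a = b := by
    intro a b hab
    rw [pow_eq_pow_iff_modEq, hc, ← ZMod.natCast_eq_natCast_iff] at hab
    simpa using hab
  choose κ hκ using hex
  refine ⟨{ toFun := κ, map_one' := hinj _ _ ?_, map_mul' := fun g h => hinj _ _ ?_ }, hκ⟩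
  · rw [← hκ, ZMod.val_one]
    simp
  · calc c ^ (κ (g * h)).val = h⁻¹ * (g⁻¹ * c * g) * h := by rw [← hκ]; group
      _ = (h⁻¹ * c * h) ^ (κ g).val := by
        rw [hκ g]
        simpa using (conj_pow (i := (κ g).val) (a := h⁻¹) (b := c)).symm
      _ = c ^ (κ g * κ h).val := by
        rw [hκ h, ← pow_mul, ZMod.val_mul, hmod, mul_comm]

/-- The eigenspaces of `c` on `V`, indexed by the exponents of its eigenvalues. -/
noncomputable def weightSpace [NeZero p] (α : G →* (A →ₐ[ℂ] A)) (V : Submodule ℂ A) (c : G)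
    (w : ZMod p) : Submodule ℂ A :=
  V ⊓ LinearMap.ker ((α c).toLinearMap - ZMod.stdAddChar w • LinearMap.id)

variable {α : G →* (A →ₐ[ℂ] A)} {V : Submodule ℂ A} {c : G}

theorem mem_weightSpace [NeZero p] {w : ZMod p} {x : A} :
    x ∈ weightSpace α V c w ↔ x ∈ V ∧ α c x = ZMod.stdAddChar w • x := by
  simp [weightSpace, sub_eq_zero]

theorem map_pow_eq_smul {f : A →ₐ[ℂ] A} {x : A} {r : ℂ} (h : f x = r • x) (i : ℕ) :
    (f ^ i) x = r ^ i • x := by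
  induction i with
  | zero => simp
  | succ i ih => rw [pow_succ', AlgHom.mul_apply, ih, map_smul, h, smul_smul, pow_succ]

theorem isWeightSystem_weightSpace [NeZero p] (hV : ∀ g, ∀ x ∈ V, α g x ∈ V)
    {κ : G →* ZMod p} (hκ : ∀ g, g⁻¹ * c * g = c ^ (κ g).val)
    (hker : κ.ker = Subgroup.zpowers c) (hfin : IsOfFinOrder c) :
    IsWeightSystem α κ (weightSpace α V c) where
  map_mem g w x hx := by
    rw [mem_weightSpace] at hx ⊢
    refine ⟨hV g x hx.1, ?_⟩
    have h : c * g = g * c ^ (κ g).val := by rw [← hκ]; group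
    rw [← AlgHom.mul_apply, ← map_mul, h, map_mul, AlgHom.mul_apply, map_pow,
      map_pow_eq_smul hx.2, map_smul, ← AddChar.map_nsmul_eq_pow, nsmul_eq_mul,
      ZMod.natCast_zmod_val]
  exists_addChar h hh := by
    have hh' : h ∈ Subgroup.zpowers c := hker ▸ hh
    obtain ⟨i, rfl⟩ := hfin.mem_powers_iff_mem_zpowers.2 hh'
    refine ⟨ZMod.stdAddChar ^ i, fun w x hx => ?_⟩
    simp only [map_pow]
    rw [map_pow_eq_smul (mem_weightSpace.1 hx).2, AddChar.pow_apply]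

theorem sum_stdAddChar_mul [Fact p.Prime] (b : ZMod p) :
    ∑ x : ZMod p, ZMod.stdAddChar (x * b) = if b = 0 then (p : ℂ) else 0 := by
  have := AddChar.sum_mulShift b (ZMod.isPrimitive_stdAddChar p)
  rw [ZMod.card] at this
  rw [this]
  split_ifs <;> simp

theorem iSup_weightSpace [Fact p.Prime] (hc : orderOf c = p) (hV : ∀ g, ∀ x ∈ V, α g x ∈ V) :
    ⨆ w : ZMod p, weightSpace α V c w = V := by
  refine le_antisymm (iSup_le fun w => inf_le_left) fun x hx => ?_
  have hsucc : ∀ i : ZMod p, c ^ (i + 1).val = c * c ^ i.val := by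
    intro i
    rw [← pow_succ', pow_eq_pow_iff_modEq, hc, ← ZMod.natCast_eq_natCast_iff]
    simp
  let e : ZMod p → A := fun w => ∑ i : ZMod p, ZMod.stdAddChar (-(w * i)) • α (c ^ i.val) x
  have he : ∀ w, e w ∈ weightSpace α V c w := by
    refine fun w => mem_weightSpace.2 ⟨sum_mem fun i _ => V.smul_mem _ (hV _ x hx), ?_⟩
    simp only [e, map_sum, map_smul, Finset.smul_sum, smul_smul]
    refine Fintype.sum_equiv (Equiv.addRight 1) _ _ fun i => ?_
    rw [Equiv.coe_addRight, hsucc, map_mul α, AlgHom.mul_apply, ← AddChar.map_add_eq_mul]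
    congr 2
    ring
  have hsum : ∑ w, e w = (p : ℂ) • x := by
    simp only [e]
    rw [Finset.sum_comm]
    simp only [← Finset.sum_smul, ← mul_neg, sum_stdAddChar_mul, neg_eq_zero, ite_smul, zero_smul]
    rw [Finset.sum_ite_eq' Finset.univ (0 : ZMod p)]
    simp
  have hp : (p : ℂ) ≠ 0 := Nat.cast_ne_zero.2 (Fact.out : p.Prime).ne_zero
  refine (Submodule.smul_mem_iff _ hp).1 (hsum ▸ sum_mem fun w _ => ?_)
  exact Submodule.mem_iSup_of_mem w (he w)

/-- Invariants of large degree lie in the ideal of decomposable elements. -/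
theorem invariant_mem_decomposableIdeal [Fact p.Prime] [Finite G] (hc : orderOf c = p)
    (hnormal : (Subgroup.zpowers c).Normal)
    (hcent : Subgroup.centralizer (Subgroup.zpowers c : Set G) = Subgroup.zpowers c)
    (hV : ∀ g, ∀ x ∈ V, α g x ∈ V) {n s : ℕ} (hn : Nat.card (G ⧸ Subgroup.zpowers c) = n)
    (hs : 0 < s) (hsmall : ∀ r : ℕ, r.Prime → r ∣ n → r ≤ s) {d : ℕ}
    (hsd : s < d) (hd : 2 * (p - 1) + ((p - 1) / s).choose 2 + (p - 1) / s ≤ d)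
    {k : ℕ} (hk : d + n * s ≤ k + s) (hk0 : 0 < k) {x : A} (hx : x ∈ V ^ k)
    (hinv : ∀ g, α g x = x) : x ∈ decomposableIdeal α V := by
  obtain ⟨κ, hκ⟩ := exists_monoidHom_conj_eq_pow hc hnormal
  have hker : κ.ker = Subgroup.zpowers c := by
    ext g
    have h1 : κ g = 1 ↔ g⁻¹ * c * g = c := by
      rw [hκ]
      constructor
      · intro h
        rw [h, ZMod.val_one, pow_one]
      · intro h
        nth_rewrite 2 [← pow_one c] at h
        rw [pow_eq_pow_iff_modEq, hc, ← ZMod.natCast_eq_natCast_iff] at h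
        simpa using h
    rw [MonoidHom.mem_ker, h1, ← hcent, Subgroup.mem_centralizer_iff]
    constructor
    · intro h y hy
      obtain ⟨i, rfl⟩ := Subgroup.mem_zpowers_iff.1 hy
      have : Commute c g := by
        rw [mul_assoc, inv_mul_eq_iff_eq_mul] at h
        exact h
      exact this.zpow_left i
    · intro h
      rw [mul_assoc, h c (Subgroup.mem_zpowers c), inv_mul_cancel_left]
  have hws := isWeightSystem_weightSpace hV hκ hker (isOfFinOrder_of_finite c)
  have hκn : ∀ g, κ g ^ n = 1 := by
    intro g
    rw [← map_pow, ← MonoidHom.mem_ker, hker, ← QuotientGroup.eq_one_iff, QuotientGroup.mk_pow,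
      ← hn, pow_card_eq_one']
  have hsup := iSup_weightSpace (α := α) hc hV
  have havg : ∀ y ∈ V ^ k, ∑ i : ZMod p, α (c ^ i.val) y ∈ decomposableIdeal α V := by
    intro y hy
    rw [← hsup] at hy
    have hy' := iSup_pow_le_iSup_weightProd _ k hy
    clear hy
    induction hy' using Submodule.iSup_induction' with
    | zero => simp
    | add y z _ _ hy hz =>
      simp only [map_add, Finset.sum_add_distrib]
      exact add_mem hy hz
    | mem β y hy' =>
      have : ∀ i : ZMod p, α (c ^ i.val) y = (ZMod.stdAddChar (i * β.1.sum) : ℂ) • y := by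
        intro i
        rw [map_pow, map_pow_eq_smul (map_eq_smul_of_mem_weightProd
          (fun w x hx => (mem_weightSpace.1 hx).2) _ y hy'), ← AddChar.map_nsmul_eq_pow,
          nsmul_eq_mul, ZMod.natCast_zmod_val]
      simp only [this, ← Finset.sum_smul, sum_stdAddChar_mul]
      split_ifs with hβ
      · refine ((decomposableIdeal α V).restrictScalars ℂ).smul_mem _ ?_
        have := hws.weightProd_le_decomposableIdeal (hker ▸ hn) hκn hs hsmall hsd hd hβ
          (by rw [β.2]; exact hk) (by rw [β.2]; exact hk0) hy'
        rwa [hsup] at this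
      · simp
  have hp : (p : ℂ) ≠ 0 := Nat.cast_ne_zero.2 (Fact.out : p.Prime).ne_zero
  have := havg x hx
  simp only [hinv, Finset.sum_const, Finset.card_univ, ZMod.card] at this
  rw [← Nat.cast_smul_eq_nsmul ℂ] at this
  exact ((decomposableIdeal α V).restrictScalars ℂ).smul_mem_iff hp |>.1 this

end WeightSpace

section Generation

open MvPolynomial

variable {G : Type*} [Group G] {m : ℕ}
  {α : G →* (MvPolynomial (Fin m) ℂ →ₐ[ℂ] MvPolynomial (Fin m) ℂ)}

theorem homogeneousComponent_map {f : MvPolynomial (Fin m) ℂ →ₐ[ℂ] MvPolynomial (Fin m) ℂ}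
    (hf : ∀ x ∈ homogeneousSubmodule (Fin m) ℂ 1, f x ∈ homogeneousSubmodule (Fin m) ℂ 1)
    (i : ℕ) (x : MvPolynomial (Fin m) ℂ) :
    homogeneousComponent i (f x) = f (homogeneousComponent i x) := by
  have hmem : ∀ j, f (homogeneousComponent j x) ∈ homogeneousSubmodule (Fin m) ℂ j := by
    intro j
    have := map_mem_pow hf j (homogeneousComponent j x)
    rw [homogeneousSubmodule_one_pow] at this
    exact this (homogeneousComponent_mem j x)
  conv_lhs => rw [← sum_homogeneousComponent x]
  simp only [map_sum, fun j => homogeneousComponent_of_mem (m := i) (hmem j)]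
  rw [Finset.sum_ite_eq]
  split_ifs with h
  · rfl
  · rw [homogeneousComponent_eq_zero _ _ (by simpa using h), map_zero]

theorem constantCoeff_eq_zero_of_mem_span {x : MvPolynomial (Fin m) ℂ}
    (hx : x ∈ Ideal.span (homogeneousSubmodule (Fin m) ℂ 1 : Set (MvPolynomial (Fin m) ℂ))) :
    constantCoeff x = 0 := by
  have : Ideal.span (homogeneousSubmodule (Fin m) ℂ 1 : Set (MvPolynomial (Fin m) ℂ)) ≤
      RingHom.ker (constantCoeff (R := ℂ) (σ := Fin m)) := by
    refine Ideal.span_le.2 fun y hy => ?_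
    rw [SetLike.mem_coe, RingHom.mem_ker, constantCoeff_eq]
    by_contra h
    have := hy h
    simp at this
  exact this hx

/-- If homogeneous invariants of degree at least `D` are decomposable, then the invariants of
degree less than `D` generate all homogeneous invariants. -/
theorem mem_adjoin_of_mem_homogeneousSubmodule [Finite G]
    (hV : ∀ g, ∀ x ∈ homogeneousSubmodule (Fin m) ℂ 1, α g x ∈ homogeneousSubmodule (Fin m) ℂ 1)
    {D : ℕ} (h : ∀ k, D < k → ∀ f ∈ homogeneousSubmodule (Fin m) ℂ k, (∀ g, α g f = f) →
      f ∈ decomposableIdeal α (homogeneousSubmodule (Fin m) ℂ 1)) (k : ℕ) :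
    ∀ f ∈ homogeneousSubmodule (Fin m) ℂ k, (∀ g, α g f = f) →
      f ∈ Algebra.adjoin ℂ {f | (∀ g, α g f = f) ∧ f.totalDegree ≤ D} := by
  have := Fintype.ofFinite G
  induction k using Nat.strong_induction_on with
  | _ k ih =>
  intro f hf hinv
  rcases le_or_gt k D with hk | hk
  · exact Algebra.subset_adjoin ⟨hinv, (IsHomogeneous.totalDegree_le hf).trans hk⟩
  set S := Algebra.adjoin ℂ {f | (∀ g, α g f = f) ∧ f.totalDegree ≤ D}
  have hgen : ∀ y ∈ positiveInvariants α (homogeneousSubmodule (Fin m) ℂ 1),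
      ∀ x ∈ Ideal.span (homogeneousSubmodule (Fin m) ℂ 1 : Set (MvPolynomial (Fin m) ℂ)),
      homogeneousComponent k (∑ g, α g (x * y)) ∈ S := by
    rintro y ⟨hy, e, he, hye⟩ x hx
    rw [homogeneousSubmodule_one_pow] at hye
    simp only [map_mul, hy, ← Finset.sum_mul]
    set t := ∑ g, α g x
    have htinv : ∀ g, α g t = t := fun g =>
      map_sum_univ g _ fun h => by rw [← AlgHom.mul_apply, ← map_mul]
    have ht0 : constantCoeff t = 0 := by
      refine constantCoeff_eq_zero_of_mem_span (sum_mem fun g _ => ?_)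
      have : Ideal.span (homogeneousSubmodule (Fin m) ℂ 1 : Set (MvPolynomial (Fin m) ℂ)) ≤
          (Ideal.span (homogeneousSubmodule (Fin m) ℂ 1 : Set (MvPolynomial (Fin m) ℂ))).comap
            (α g) :=
        Ideal.span_le.2 fun z hz => Ideal.subset_span (hV g z hz)
      exact this hx
    rw [← sum_homogeneousComponent t, Finset.sum_mul, map_sum]
    refine sum_mem fun i _ => ?_
    have hmem : homogeneousComponent i t * y ∈ homogeneousSubmodule (Fin m) ℂ (i + e) :=
      IsHomogeneous.mul (homogeneousComponent_mem i t) hye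
    rw [homogeneousComponent_of_mem hmem]
    split_ifs with hik
    · rcases Nat.eq_zero_or_pos i with rfl | hi
      · rw [homogeneousComponent_zero, ← constantCoeff_eq, ht0, C_0, zero_mul]
        exact zero_mem _
      · refine mul_mem (ih i (by omega) _ (homogeneousComponent_mem i t) fun g => ?_)
          (ih e (by omega) y hye hy)
        rw [← homogeneousComponent_map (hV g), htinv]
    · exact zero_mem _
  have hideal : ∀ z ∈ decomposableIdeal α (homogeneousSubmodule (Fin m) ℂ 1),
      homogeneousComponent k (∑ g, α g z) ∈ S := by
    intro z hz
    refine Submodule.mul_induction_on hz (fun x hx y hy => ?_) fun y z hy hz => ?_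
    · induction hy using Submodule.span_induction generalizing x with
      | mem y hy => exact hgen y hy x hx
      | zero => simp
      | add y z _ _ hy hz =>
        simp only [mul_add, map_add, Finset.sum_add_distrib]
        exact add_mem (hy x hx) (hz x hx)
      | smul a y _ ih =>
        rw [smul_eq_mul, mul_left_comm, ← mul_assoc]
        exact ih _ (Ideal.mul_mem_left _ a hx)
    · simp only [map_add, Finset.sum_add_distrib]
      exact add_mem hy hz
  have := hideal f (h k hk f hf hinv)
  simp only [hinv, Finset.sum_const, Finset.card_univ] at this
  rw [← Nat.cast_smul_eq_nsmul ℂ, map_smul, homogeneousComponent_of_mem hf, if_pos rfl] at this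
  exact (Submodule.smul_mem_iff (Subalgebra.toSubmodule S)
    (Nat.cast_ne_zero.2 Fintype.card_ne_zero)).1 this

theorem adjoin_eq_of_decomposable [Finite G]
    (hV : ∀ g, ∀ x ∈ homogeneousSubmodule (Fin m) ℂ 1, α g x ∈ homogeneousSubmodule (Fin m) ℂ 1)
    {D : ℕ} (h : ∀ k, D < k → ∀ f ∈ homogeneousSubmodule (Fin m) ℂ k, (∀ g, α g f = f) →
      f ∈ decomposableIdeal α (homogeneousSubmodule (Fin m) ℂ 1))
    {f : MvPolynomial (Fin m) ℂ} (hf : ∀ g, α g f = f) :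
    f ∈ Algebra.adjoin ℂ {f | (∀ g, α g f = f) ∧ f.totalDegree ≤ D} := by
  rw [← sum_homogeneousComponent f]
  refine sum_mem fun i _ => ?_
  refine mem_adjoin_of_mem_homogeneousSubmodule hV h i _ (homogeneousComponent_mem i f) fun g => ?_
  rw [← homogeneousComponent_map (hV g), hf]

end Generation

namespace Representation

open MvPolynomial

variable {G : Type*} [Group G] {m : ℕ} (ρ : Representation ℂ G (Fin m → ℂ))

theorem polySubst_one_s4 : ρ.polySubst 1 = AlgHom.id ℂ _ := by
  refine MvPolynomial.algHom_ext fun i => ?_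
  rw [polySubst, aeval_X, map_one, LinearMap.toMatrix'_one, Finset.sum_eq_single i]
  · simp
  · intro j _ hj
    simp [Matrix.one_apply_ne hj.symm]
  · simp

theorem polySubst_mul_s4 (g h : G) :
    ρ.polySubst (g * h) = (ρ.polySubst h).comp (ρ.polySubst g) := by
  refine MvPolynomial.algHom_ext fun i => ?_
  simp only [polySubst, map_mul, AlgHom.comp_apply, aeval_X, Module.End.mul_eq_comp,
    LinearMap.toMatrix'_comp, Matrix.mul_apply, map_sum, algHom_C, Finset.mul_sum, Finset.sum_mul,
    MvPolynomial.algebraMap_eq]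
  rw [Finset.sum_comm]
  simp only [mul_assoc]

/-- The left action of `G` on polynomials by substitutions. -/
noncomputable def polyAction :
    G →* (MvPolynomial (Fin m) ℂ →ₐ[ℂ] MvPolynomial (Fin m) ℂ) where
  toFun g := ρ.polySubst g⁻¹
  map_one' := by rw [inv_one, polySubst_one_s4]; rfl
  map_mul' g h := by rw [mul_inv_rev, polySubst_mul_s4]; rfl

theorem polyAction_mem (g : G) :
    ∀ x ∈ homogeneousSubmodule (Fin m) ℂ 1,
      ρ.polyAction g x ∈ homogeneousSubmodule (Fin m) ℂ 1 := by
  intro x hx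
  rw [homogeneousSubmodule_one_eq_span_X] at hx
  induction hx using Submodule.span_induction with
  | mem x hx =>
    obtain ⟨i, rfl⟩ := hx
    have : ρ.polyAction g (X i) =
        ∑ j, C (LinearMap.toMatrix' (ρ g⁻¹) i j) * X j := aeval_X _ _
    rw [this]
    refine sum_mem fun j _ => ?_
    rw [C_mul']
    exact Submodule.smul_mem _ _ (isHomogeneous_X ℂ j)
  | zero => simp
  | add x y _ _ hx hy => rw [map_add]; exact add_mem hx hy
  | smul a x _ hx => rw [map_smul]; exact Submodule.smul_mem _ a hx

theorem mem_invariantAlgebra_s4 {f : MvPolynomial (Fin m) ℂ} :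
    f ∈ ρ.invariantAlgebra ↔ ∀ g, ρ.polyAction g f = f := by
  simp only [invariantAlgebra, Algebra.mem_iInf, AlgHom.mem_equalizer, AlgHom.id_apply]
  exact ⟨fun h g => h g⁻¹, fun h g => by simpa [polyAction] using h g⁻¹⟩

theorem invariantsGeneratedInDegree_of_decomposable [Finite G] {D : ℕ}
    (h : ∀ k, D < k → ∀ f ∈ homogeneousSubmodule (Fin m) ℂ k, (∀ g, ρ.polyAction g f = f) →
      f ∈ decomposableIdeal ρ.polyAction (homogeneousSubmodule (Fin m) ℂ 1)) :
    ρ.InvariantsGeneratedInDegree D := by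
  refine le_antisymm (Algebra.adjoin_le fun f hf => hf.1) fun f hf => ?_
  simp only [mem_invariantAlgebra_s4] at hf ⊢
  exact adjoin_eq_of_decomposable ρ.polyAction_mem h hf

end Representation

/-- The degree bound is below `2p√n`. -/
theorem degree_bound_lt {p n s : ℕ} (hn : 6 ≤ n) (hnp : n + 1 ≤ p) (hs : 3 ≤ s)
    (hsp : s = ⌊(p : ℝ) / √n⌋₊) :
    ((2 * (p - 1) + ((p - 1) / s).choose 2 + (p - 1) / s + n * s - s - 1 : ℕ) : ℝ) <
      2 * p * √n := by
  set c := (p - 1) / s with hc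
  set x := √(n : ℝ) with hx
  have hx2 : x * x = n := Real.mul_self_sqrt (Nat.cast_nonneg n)
  have hx0 : 0 < x := Real.sqrt_pos.2 (by positivity)
  have hn' : (6 : ℝ) ≤ n := by exact_mod_cast hn
  have hnp' : (n : ℝ) + 1 ≤ p := by exact_mod_cast hnp
  have hs' : (3 : ℝ) ≤ s := by exact_mod_cast hs
  have hsx : s * x ≤ p := by
    rw [← le_div_iff₀ hx0, hsp]
    exact Nat.floor_le (by positivity)
  have hpx : p < (s + 1) * x := by
    rw [← div_lt_iff₀ hx0, hsp]
    exact Nat.lt_floor_add_one _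
  have hcs : (c : ℝ) * s ≤ p := by
    exact_mod_cast (Nat.div_mul_le_self (p - 1) s).trans (Nat.sub_le p 1)
  have hcx : (c : ℝ) ≤ 4 / 3 * x := by
    refine le_of_mul_le_mul_right (hcs.trans (hpx.le.trans ?_)) (by linarith : (0 : ℝ) < s)
    nlinarith
  have hE : 2 * (p - 1) + c.choose 2 + c + n * s - s - 1 + s + 3 =
      2 * p + c.choose 2 + c + n * s := by
    have : s ≤ n * s := Nat.le_mul_of_pos_left s (by omega)
    have := Nat.zero_le ((p - 1) / s)
    omega
  have hE' : ((2 * (p - 1) + c.choose 2 + c + n * s - s - 1 : ℕ) : ℝ) + s + 3 =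
      2 * p + c * (c - 1) / 2 + c + n * s := by
    rw [← Nat.cast_choose_two]
    exact_mod_cast hE
  have hns : (n : ℝ) * s ≤ p * x := by nlinarith
  have hcc : (c : ℝ) * c ≤ 16 / 9 * n := by
    nlinarith [Nat.cast_nonneg (α := ℝ) c]
  have hx245 : 2.4 ≤ x := by
    by_contra h
    nlinarith
  have hpoly : (n + 1) * (x - 2) ≤ p * (x - 2) := by
    gcongr
    linarith
  nlinarith [mul_nonneg (mul_nonneg hx0.le hx0.le) (sub_nonneg.2 hx245)]

/-- Under the hypothesis on the prime divisors of `n`, the quotient `p/√n` is at least `3`. -/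
theorem three_le_floor {p n : ℕ} (hn : 6 ≤ n) (hnp : n + 1 ≤ p)
    (hsmall : ∀ r : ℕ, r.Prime → r ∣ n → (r : ℝ) ≤ (p : ℝ) / √n) : 3 ≤ ⌊(p : ℝ) / √n⌋₊ := by
  refine Nat.le_floor ?_
  rcases eq_or_lt_of_le hn with rfl | hn7
  · exact_mod_cast hsmall 3 Nat.prime_three (by norm_num)
  have hx0 : 0 < √(n : ℝ) := Real.sqrt_pos.2 (by positivity)
  rw [Nat.cast_ofNat, le_div_iff₀ hx0]
  have hnp' : (n : ℝ) + 1 ≤ p := by exact_mod_cast hnp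
  have hn' : (7 : ℝ) ≤ n := by exact_mod_cast hn7
  have hx2 : √(n : ℝ) * √n = n := Real.mul_self_sqrt (Nat.cast_nonneg n)
  have : 2.64 ≤ √(n : ℝ) := by
    by_contra h
    nlinarith
  nlinarith

/-- **Theorem (Frobenius groups of order pn).**  Let `G` be the Frobenius group of
order `p * n`, i.e. `G` has a normal subgroup `N` of prime order `p` with
`C_G(N) = N` and `G/N` cyclic of order `n`, where `n ∣ p - 1`.  If `n ≥ 6` and no
prime divisor of `n` exceeds `p/√n`, then `β(G) < 2p√n`. -/
theorem noetherNumber_lt_of_frobenius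
    (p n : ℕ) (hp : p.Prime) (hdvd : n ∣ p - 1)
    (G : Type) [Group G] [Finite G] (N : Subgroup G) (hN : N.Normal)
    (hcardN : Nat.card N = p)
    (hcent : Subgroup.centralizer (N : Set G) = N)
    (hcyc : IsCyclic (G ⧸ N)) (hcardQ : Nat.card (G ⧸ N) = n)
    (hn6 : 6 ≤ n)
    (hsmall : ∀ r : ℕ, r.Prime → r ∣ n → (r : ℝ) ≤ (p : ℝ) / Real.sqrt n) :
    (noetherNumber G : ℝ) < 2 * (p : ℝ) * Real.sqrt n := by
  have : Fact p.Prime := ⟨hp⟩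
  have : IsCyclic N := isCyclic_of_prime_card hcardN
  obtain ⟨c, rfl⟩ := Subgroup.isCyclic_iff_exists_zpowers_eq_top N |>.1 this
  have hc : orderOf c = p := by rw [← Nat.card_zpowers, hcardN]
  have hnp : n + 1 ≤ p := by
    have := Nat.le_of_dvd (Nat.sub_pos_of_lt hp.one_lt) hdvd
    have := hp.one_lt
    omega
  obtain ⟨s, hs⟩ : ∃ s, s = ⌊(p : ℝ) / √n⌋₊ := ⟨_, rfl⟩
  have hs3 : 3 ≤ s := hs ▸ three_le_floor hn6 hnp hsmall
  have hsp : s ≤ p := by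
    rw [hs]
    refine Nat.floor_le_of_le (div_le_self (Nat.cast_nonneg p) ?_)
    exact Real.one_le_sqrt.2 (by exact_mod_cast (by omega : 1 ≤ n))
  refine lt_of_le_of_lt (Nat.cast_le.2 (Nat.sInf_le ?_)) (degree_bound_lt hn6 hnp hs3 hs)
  intro m ρ
  refine ρ.invariantsGeneratedInDegree_of_decomposable fun k hk f hf hinv => ?_
  rw [← MvPolynomial.homogeneousSubmodule_one_pow] at hf
  have hns : s ≤ n * s := Nat.le_mul_of_pos_left s (by omega)
  have := Nat.zero_le ((p - 1) / s)
  exact invariant_mem_decomposableIdeal hc hN hcent ρ.polyAction_mem hcardQ (by omega)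
    (fun r hr hrn => hs ▸ Nat.le_floor (hsmall r hr hrn)) (by omega) le_rfl (by omega) (by omega)
    hf hinv
end
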